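/- For all integers k,s ≥ 1 and c ∈ {0,1}, an F-basis of T₁(A^{k,s}_c) = {x ∈ A^{k,s}_c : x² ∈ K(A^{k,s}_c)} is given by 𝓣 = 𝓚 ∪ {(αβγ)^i : ⌈(k+1)/2⌉ ≤ i ≤ k−1} ∪ {η^j : ⌈(s+1)/2⌉ ≤ j ≤ s} ∪ 𝓝, where 𝓝 = {α} if c = 0 and k or s is odd; 𝓝 = {α, (αβγ)^{⌊k/2⌋} + η^{⌊s/2⌋}} if c = 0 and k,s are both even; 𝓝 = ∅ if c = 1 and k,s are both odd; 𝓝 = {α + η^{⌊s/2⌋}} if c = 1, k is odd and s is even; 𝓝 = {α + (αβγ)^{⌊k/2⌋}} if c = 1, k is even and s is odd; and 𝓝 = {α + (αβγ)^{⌊k/2⌋}, (αβγ)^{⌊k/2⌋} + η^{⌊s/2⌋}} if c = 1 and k,s are both even. -/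

import Mathlib

/- Common setup: the algebras D(2B)^{k,s}(c) of dihedral type, over a field F,
   presented as a quotient of the free algebra on the paths-generators
   e₁, e₂ (trivial paths), α (loop at vertex 1), β (arrow 1 → 2),
   γ (arrow 2 → 1), η (loop at vertex 2), by the path-algebra relations
   together with Erdmann's relations
   βη = 0, ηγ = 0, γβ = 0, α² = c(αβγ)^k, (αβγ)^k = (βγα)^k, η^s = (γαβ)^k. -/

noncomputable section

namespace DihedralPaper

inductive Gen : Type
  | e1 | e2 | a | b | g | h

variable (F : Type) [Field F]

/-- The generators inside the free algebra. -/
def gen (t : Gen) : FreeAlgebra F Gen := FreeAlgebra.ι F t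

/-- The defining relations of `D(2B)^{k,s}(c)` (paths written from left to right). -/
inductive Rel (k s : ℕ) (c : F) : FreeAlgebra F Gen → FreeAlgebra F Gen → Prop
  | unit : Rel k s c (gen F .e1 + gen F .e2) 1
  | idem1 : Rel k s c (gen F .e1 * gen F .e1) (gen F .e1)
  | idem2 : Rel k s c (gen F .e2 * gen F .e2) (gen F .e2)
  | orth12 : Rel k s c (gen F .e1 * gen F .e2) 0
  | orth21 : Rel k s c (gen F .e2 * gen F .e1) 0
  | aL : Rel k s c (gen F .e1 * gen F .a) (gen F .a)
  | aR : Rel k s c (gen F .a * gen F .e1) (gen F .a)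
  | bL : Rel k s c (gen F .e1 * gen F .b) (gen F .b)
  | bR : Rel k s c (gen F .b * gen F .e2) (gen F .b)
  | gL : Rel k s c (gen F .e2 * gen F .g) (gen F .g)
  | gR : Rel k s c (gen F .g * gen F .e1) (gen F .g)
  | hL : Rel k s c (gen F .e2 * gen F .h) (gen F .h)
  | hR : Rel k s c (gen F .h * gen F .e2) (gen F .h)
  | bh : Rel k s c (gen F .b * gen F .h) 0
  | hg : Rel k s c (gen F .h * gen F .g) 0
  | gb : Rel k s c (gen F .g * gen F .b) 0
  | asq : Rel k s c (gen F .a * gen F .a) (c • (gen F .a * gen F .b * gen F .g) ^ k)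
  | abg : Rel k s c ((gen F .a * gen F .b * gen F .g) ^ k) ((gen F .b * gen F .g * gen F .a) ^ k)
  | hs : Rel k s c ((gen F .h) ^ s) ((gen F .g * gen F .a * gen F .b) ^ k)

/-- The algebra `A^{k,s}_c = D(2B)^{k,s}(c)`. -/
def DA (k s : ℕ) (c : F) : Type := RingQuot (Rel F k s c)

instance (k s : ℕ) (c : F) : Ring (DA F k s c) :=
  inferInstanceAs (Ring (RingQuot (Rel F k s c)))

instance (k s : ℕ) (c : F) : Algebra F (DA F k s c) :=
  inferInstanceAs (Algebra F (RingQuot (Rel F k s c)))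

variable (k s : ℕ) (c : F)

/-- The canonical projection. -/
def mk : FreeAlgebra F Gen →ₐ[F] DA F k s c := RingQuot.mkAlgHom F (Rel F k s c)

def E1 : DA F k s c := mk F k s c (gen F .e1)
def E2 : DA F k s c := mk F k s c (gen F .e2)
/-- The image of the loop α at vertex 1. -/
def Al : DA F k s c := mk F k s c (gen F .a)
/-- The image of the arrow β : 1 → 2. -/
def Be : DA F k s c := mk F k s c (gen F .b)
/-- The image of the arrow γ : 2 → 1. -/
def Ga : DA F k s c := mk F k s c (gen F .g)
/-- The image of the loop η at vertex 2. -/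
def Et : DA F k s c := mk F k s c (gen F .h)

/-- The path αβγ. -/
def ABG : DA F k s c := Al F k s c * Be F k s c * Ga F k s c
/-- The path βγα. -/
def BGA : DA F k s c := Be F k s c * Ga F k s c * Al F k s c
/-- The path γαβ. -/
def GAB : DA F k s c := Ga F k s c * Al F k s c * Be F k s c

/-- The standard basis paths 𝓑₁₁ of e₁Ae₁. -/
def B11 : Set (DA F k s c) :=
  {E1 F k s c, Al F k s c, Be F k s c * Ga F k s c, (ABG F k s c) ^ k}
    ∪ (fun i => (ABG F k s c) ^ i) '' Set.Icc 1 (k - 1)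
    ∪ (fun i => (ABG F k s c) ^ i * Al F k s c) '' Set.Icc 1 (k - 1)
    ∪ (fun i => (BGA F k s c) ^ i) '' Set.Icc 1 (k - 1)
    ∪ (fun i => (BGA F k s c) ^ i * (Be F k s c * Ga F k s c)) '' Set.Icc 1 (k - 1)

/-- The standard basis paths 𝓑₁₂ of e₁Ae₂. -/
def B12 : Set (DA F k s c) :=
  {Be F k s c, Al F k s c * Be F k s c}
    ∪ (fun i => (BGA F k s c) ^ i * Be F k s c) '' Set.Icc 1 (k - 1)
    ∪ (fun i => (ABG F k s c) ^ i * (Al F k s c * Be F k s c)) '' Set.Icc 1 (k - 1)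

/-- The standard basis paths 𝓑₂₁ of e₂Ae₁. -/
def B21 : Set (DA F k s c) :=
  {Ga F k s c, Ga F k s c * Al F k s c}
    ∪ (fun i => (GAB F k s c) ^ i * Ga F k s c) '' Set.Icc 1 (k - 1)
    ∪ (fun i => (GAB F k s c) ^ i * (Ga F k s c * Al F k s c)) '' Set.Icc 1 (k - 1)

/-- The standard basis paths 𝓑₂₂ of e₂Ae₂. -/
def B22 : Set (DA F k s c) :=
  {E2 F k s c}
    ∪ (fun i => (GAB F k s c) ^ i) '' Set.Icc 1 (k - 1)
    ∪ (fun j => (Et F k s c) ^ j) '' Set.Icc 1 s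

/-- The standard path basis 𝓑 of `A^{k,s}_c`. -/
def BB : Set (DA F k s c) :=
  B11 F k s c ∪ B12 F k s c ∪ B21 F k s c ∪ B22 F k s c

/-- The commutator subspace K(A): the F-linear span of all commutators. -/
def Kspan (A : Type) [Ring A] [Algebra F A] : Submodule F A :=
  Submodule.span F {z : A | ∃ u v : A, z = u * v - v * u}

/-- The (left) socle of a ring: the sum of all simple (left) submodules. -/
def socle (A : Type) [Ring A] : Submodule A A := sSup {S : Submodule A A | IsAtom S}

/-- `ψ` is the linear form sending each standard basis path lying in the socle to 1
    and every other standard basis path to 0. -/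
def SoclePsi (ψ : DA F k s c →ₗ[F] F) : Prop :=
  ∀ p ∈ BB F k s c,
    (p ∈ socle (DA F k s c) → ψ p = 1) ∧ (p ∉ socle (DA F k s c) → ψ p = 0)

/-- `T₁(A) = {x : x² ∈ K(A)}`. -/
def T1set : Set (DA F k s c) := {z | z ^ 2 ∈ Kspan F (DA F k s c)}

/-- The orthogonal space `T₁(A)^⊥` with respect to the form `⟨x, y⟩ = ψ(xy)`. -/
def T1perp (ψ : DA F k s c →ₗ[F] F) : Set (DA F k s c) :=
  {y | ∀ x ∈ T1set F k s c, ψ (y * x) = 0}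

/-- The first generalized Reynolds ideal, as an ideal of the center `Z(A)`. -/
def ReynoldsIdeal (ψ : DA F k s c →ₗ[F] F) :
    Ideal (Subalgebra.center F (DA F k s c)) :=
  Ideal.span {z : Subalgebra.center F (DA F k s c) | (z : DA F k s c) ∈ T1perp F k s c ψ}


/-- The set 𝓚₁₁. -/
def K11 : Set (DA F k s c) :=
  {Be F k s c * Ga F k s c}
    ∪ (fun i => (ABG F k s c) ^ i + (BGA F k s c) ^ i) '' Set.Icc 1 (k - 1)
    ∪ (fun i => (ABG F k s c) ^ i * Al F k s c) '' Set.Icc 1 (k - 1)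
    ∪ (fun i => (BGA F k s c) ^ i * (Be F k s c * Ga F k s c)) '' Set.Icc 1 (k - 1)

/-- The set 𝓚₂₂. -/
def K22 : Set (DA F k s c) :=
  (fun i => (ABG F k s c) ^ i + (GAB F k s c) ^ i) '' Set.Icc 1 k

/-- The set 𝓚 = 𝓑₁₂ ∪ 𝓑₂₁ ∪ 𝓚₁₁ ∪ 𝓚₂₂, a basis of the commutator subspace. -/
def KK : Set (DA F k s c) :=
  B12 F k s c ∪ B21 F k s c ∪ K11 F k s c ∪ K22 F k s c

open Classical in
/-- The set 𝓝 of Lemma 4.3, depending on the scalar `c` and the parities of `k`, `s`. -/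
def NN : Set (DA F k s c) :=
  if c = 0 then
    (if Odd k ∨ Odd s then {Al F k s c}
     else {Al F k s c, (ABG F k s c) ^ (k / 2) + (Et F k s c) ^ (s / 2)})
  else
    (if Odd k ∧ Odd s then ∅
     else if Odd k ∧ Even s then {Al F k s c + (Et F k s c) ^ (s / 2)}
     else if Even k ∧ Odd s then {Al F k s c + (ABG F k s c) ^ (k / 2)}
     else {Al F k s c + (ABG F k s c) ^ (k / 2),
           (ABG F k s c) ^ (k / 2) + (Et F k s c) ^ (s / 2)})

/-- The set 𝓣 of Lemma 4.3:
`𝓣 = 𝓚 ∪ {(αβγ)^i : ⌈(k+1)/2⌉ ≤ i ≤ k-1} ∪ {η^j : ⌈(s+1)/2⌉ ≤ j ≤ s} ∪ 𝓝`. -/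
def TT : Set (DA F k s c) :=
  KK F k s c
    ∪ (fun i => (ABG F k s c) ^ i) '' Set.Icc ((k + 2) / 2) (k - 1)
    ∪ (fun j => (Et F k s c) ^ j) '' Set.Icc ((s + 2) / 2) s
    ∪ NN F k s c

/-- Elements of an algebra satisfying the defining relations of `D(2B)^{k,s}(c)`. -/
structure DRel {F A : Type} [Field F] [Ring A] [Algebra F A] (k s : ℕ) (c : F)
    (e₁ e₂ a b g h : A) : Prop where
  unit : e₁ + e₂ = 1
  idem1 : e₁ * e₁ = e₁
  idem2 : e₂ * e₂ = e₂
  orth12 : e₁ * e₂ = 0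
  orth21 : e₂ * e₁ = 0
  aL : e₁ * a = a
  aR : a * e₁ = a
  bL : e₁ * b = b
  bR : b * e₂ = b
  gL : e₂ * g = g
  gR : g * e₁ = g
  hL : e₂ * h = h
  hR : h * e₂ = h
  bh : b * h = 0
  hg : h * g = 0
  gb : g * b = 0
  asq : a * a = c • (a * b * g) ^ k
  abg : (a * b * g) ^ k = (b * g * a) ^ k
  hs : h ^ s = (g * a * b) ^ k

namespace DRel

variable {F A : Type} [Field F] [Ring A] [Algebra F A] {k s : ℕ} {c : F}
  {e₁ e₂ a b g h : A}

theorem a_e2 (R : DRel k s c e₁ e₂ a b g h) : a * e₂ = 0 := by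
  rw [← R.aR, mul_assoc, R.orth12, mul_zero]

theorem b_e1 (R : DRel k s c e₁ e₂ a b g h) : b * e₁ = 0 := by
  rw [← R.bR, mul_assoc, R.orth21, mul_zero]

theorem g_e2 (R : DRel k s c e₁ e₂ a b g h) : g * e₂ = 0 := by
  rw [← R.gR, mul_assoc, R.orth12, mul_zero]

theorem h_e1 (R : DRel k s c e₁ e₂ a b g h) : h * e₁ = 0 := by
  rw [← R.hR, mul_assoc, R.orth21, mul_zero]

theorem e2_a (R : DRel k s c e₁ e₂ a b g h) : e₂ * a = 0 := by
  rw [← R.aL, ← mul_assoc, R.orth21, zero_mul]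

theorem e2_b (R : DRel k s c e₁ e₂ a b g h) : e₂ * b = 0 := by
  rw [← R.bL, ← mul_assoc, R.orth21, zero_mul]

theorem e1_g (R : DRel k s c e₁ e₂ a b g h) : e₁ * g = 0 := by
  rw [← R.gL, ← mul_assoc, R.orth12, zero_mul]

theorem e1_h (R : DRel k s c e₁ e₂ a b g h) : e₁ * h = 0 := by
  rw [← R.hL, ← mul_assoc, R.orth12, zero_mul]

theorem a_g (R : DRel k s c e₁ e₂ a b g h) : a * g = 0 := by
  rw [← R.gL, ← mul_assoc, R.a_e2, zero_mul]

theorem a_h (R : DRel k s c e₁ e₂ a b g h) : a * h = 0 := by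
  rw [← R.hL, ← mul_assoc, R.a_e2, zero_mul]

theorem b_a (R : DRel k s c e₁ e₂ a b g h) : b * a = 0 := by
  rw [← R.aL, ← mul_assoc, R.b_e1, zero_mul]

theorem b_b (R : DRel k s c e₁ e₂ a b g h) : b * b = 0 := by
  rw [← R.bL, ← mul_assoc, R.bL, R.b_e1, zero_mul]

theorem g_g (R : DRel k s c e₁ e₂ a b g h) : g * g = 0 := by
  rw [← R.gL, ← mul_assoc, R.gL, R.g_e2, zero_mul]

theorem g_h (R : DRel k s c e₁ e₂ a b g h) : g * h = 0 := by
  rw [← R.hL, ← mul_assoc, R.g_e2, zero_mul]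

theorem h_a (R : DRel k s c e₁ e₂ a b g h) : h * a = 0 := by
  rw [← R.aL, ← mul_assoc, R.h_e1, zero_mul]

theorem h_b (R : DRel k s c e₁ e₂ a b g h) : h * b = 0 := by
  rw [← R.bL, ← mul_assoc, R.h_e1, zero_mul]

theorem abg_pow_mul_a (n : ℕ) : (a * b * g) ^ n * a = a * (b * g * a) ^ n := by
  induction n with
  | zero => simp
  | succ n ih => rw [pow_succ', pow_succ', mul_assoc, ih]; simp only [mul_assoc]

theorem bga_pow_mul_b (n : ℕ) : (b * g * a) ^ n * b = b * (g * a * b) ^ n := by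
  induction n with
  | zero => simp
  | succ n ih => rw [pow_succ', pow_succ', mul_assoc, ih]; simp only [mul_assoc]

theorem gab_pow_mul_g (n : ℕ) : (g * a * b) ^ n * g = g * (a * b * g) ^ n := by
  induction n with
  | zero => simp
  | succ n ih => rw [pow_succ', pow_succ', mul_assoc, ih]; simp only [mul_assoc]

theorem abg_pow_mul_ab (n : ℕ) : (a * b * g) ^ n * (a * b) = a * b * (g * a * b) ^ n := by
  induction n with
  | zero => simp
  | succ n ih => rw [pow_succ', pow_succ', mul_assoc, ih]; simp only [mul_assoc]

theorem g_mul_abg_pow (R : DRel k s c e₁ e₂ a b g h) (hk : 1 ≤ k) : g * (a * b * g) ^ k = 0 := by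
  obtain ⟨n, rfl⟩ := Nat.exists_eq_add_of_le' hk
  rw [R.abg, pow_succ', mul_assoc b, mul_assoc, ← mul_assoc, R.gb, zero_mul]

theorem abg_pow_mul_b (R : DRel k s c e₁ e₂ a b g h) (hk : 1 ≤ k) :
    (a * b * g) ^ k * b = 0 := by
  obtain ⟨n, rfl⟩ := Nat.exists_eq_add_of_le' hk
  rw [pow_succ, mul_assoc, mul_assoc (a * b), R.gb, mul_zero, mul_zero]

theorem g_mul_aa (R : DRel k s c e₁ e₂ a b g h) (hk : 1 ≤ k) : g * (a * a) = 0 := by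
  rw [R.asq, mul_smul_comm, R.g_mul_abg_pow hk, smul_zero]

theorem abg_pow_k_mul_a (R : DRel k s c e₁ e₂ a b g h) (hk : 1 ≤ k) :
    (a * b * g) ^ k * a = 0 := by
  obtain ⟨n, rfl⟩ := Nat.exists_eq_add_of_le' hk
  rw [R.abg, pow_succ, mul_assoc, mul_assoc (b * g), mul_assoc b g (a * a), R.g_mul_aa hk,
    mul_zero, mul_zero]

theorem gab_pow_mul_gab_zero (R : DRel k s c e₁ e₂ a b g h) (hk : 1 ≤ k) :
    (g * a * b) ^ k * g = 0 := by
  rw [gab_pow_mul_g, R.g_mul_abg_pow hk]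

theorem h_pow_zero (R : DRel k s c e₁ e₂ a b g h) (hk : 1 ≤ k) : h ^ s * h = 0 := by
  obtain ⟨n, rfl⟩ := Nat.exists_eq_add_of_le' hk
  rw [R.hs, pow_succ, mul_assoc, mul_assoc (g * a), R.bh, mul_zero, mul_zero]

theorem pow_mul_of_le {x y : A} {m n : ℕ} (hmn : m ≤ n) (h0 : x ^ m * y = 0)
    (hxy : ∃ z, x ^ m * x = x ^ m * y * z) : x ^ n * y = 0 := by
  obtain ⟨d, rfl⟩ := Nat.exists_eq_add_of_le hmn
  obtain ⟨z, hz⟩ := hxy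
  rcases d with _ | d
  · simpa using h0
  · rw [pow_add, pow_succ', ← mul_assoc (x ^ m) x, hz, h0, zero_mul, zero_mul, zero_mul]

theorem abg_pow_mul_a_of_le (R : DRel k s c e₁ e₂ a b g h) (hk : 1 ≤ k) {n : ℕ} (hn : k ≤ n) :
    (a * b * g) ^ n * a = 0 :=
  pow_mul_of_le hn (R.abg_pow_k_mul_a hk) ⟨b * g, by simp only [mul_assoc]⟩

theorem abg_pow_of_lt (R : DRel k s c e₁ e₂ a b g h) (hk : 1 ≤ k) {n : ℕ} (hn : k < n) :
    (a * b * g) ^ n = 0 := by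
  obtain ⟨m, rfl⟩ := Nat.exists_eq_add_of_le' (Nat.one_le_of_lt hn)
  have hm : (a * b * g) ^ m * (a * b * g) = (a * b * g) ^ m * a * (b * g) := by
    simp only [mul_assoc]
  rw [pow_succ, hm, R.abg_pow_mul_a_of_le hk (by omega), zero_mul]

theorem bga_pow_mul_b_of_le (R : DRel k s c e₁ e₂ a b g h) (hk : 1 ≤ k) {n : ℕ} (hn : k ≤ n) :
    (b * g * a) ^ n * b = 0 :=
  pow_mul_of_le hn (by rw [← R.abg, R.abg_pow_mul_b hk]) ⟨g * a, by simp only [mul_assoc]⟩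

theorem bga_pow_of_lt (R : DRel k s c e₁ e₂ a b g h) (hk : 1 ≤ k) {n : ℕ} (hn : k < n) :
    (b * g * a) ^ n = 0 := by
  obtain ⟨m, rfl⟩ := Nat.exists_eq_add_of_le' (Nat.one_le_of_lt hn)
  have hm : (b * g * a) ^ m * (b * g * a) = (b * g * a) ^ m * b * (g * a) := by
    simp only [mul_assoc]
  rw [pow_succ, hm, R.bga_pow_mul_b_of_le hk (by omega), zero_mul]

theorem gab_pow_mul_g_of_le (R : DRel k s c e₁ e₂ a b g h) (hk : 1 ≤ k) {n : ℕ} (hn : k ≤ n) :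
    (g * a * b) ^ n * g = 0 :=
  pow_mul_of_le hn (R.gab_pow_mul_gab_zero hk) ⟨a * b, by simp only [mul_assoc]⟩

theorem gab_pow_of_lt (R : DRel k s c e₁ e₂ a b g h) (hk : 1 ≤ k) {n : ℕ} (hn : k < n) :
    (g * a * b) ^ n = 0 := by
  obtain ⟨m, rfl⟩ := Nat.exists_eq_add_of_le' (Nat.one_le_of_lt hn)
  have hm : (g * a * b) ^ m * (g * a * b) = (g * a * b) ^ m * g * (a * b) := by
    simp only [mul_assoc]
  rw [pow_succ, hm, R.gab_pow_mul_g_of_le hk (by omega), zero_mul]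

theorem h_pow_of_lt (R : DRel k s c e₁ e₂ a b g h) (hk : 1 ≤ k) {n : ℕ} (hn : s < n) :
    h ^ n = 0 := by
  obtain ⟨m, rfl⟩ := Nat.exists_eq_add_of_le' (Nat.one_le_of_lt hn)
  rw [pow_succ]
  exact pow_mul_of_le (by omega) (R.h_pow_zero hk) ⟨1, by simp⟩

end DRel

variable {F k s c} in
theorem mk_eq_of_Rel {x y : FreeAlgebra F Gen} (h : Rel F k s c x y) :
    mk F k s c x = mk F k s c y :=
  RingQuot.mkAlgHom_rel F h

theorem dRel_DA : DRel k s c (E1 F k s c) (E2 F k s c) (Al F k s c) (Be F k s c) (Ga F k s c)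
    (Et F k s c) where
  unit := by simpa [E1, E2] using mk_eq_of_Rel (F := F) (c := c) (.unit (k := k) (s := s))
  idem1 := by simpa [E1] using mk_eq_of_Rel (F := F) (c := c) (.idem1 (k := k) (s := s))
  idem2 := by simpa [E2] using mk_eq_of_Rel (F := F) (c := c) (.idem2 (k := k) (s := s))
  orth12 := by simpa [E1, E2] using mk_eq_of_Rel (F := F) (c := c) (.orth12 (k := k) (s := s))
  orth21 := by simpa [E1, E2] using mk_eq_of_Rel (F := F) (c := c) (.orth21 (k := k) (s := s))
  aL := by simpa [E1, Al] using mk_eq_of_Rel (F := F) (c := c) (.aL (k := k) (s := s))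
  aR := by simpa [E1, Al] using mk_eq_of_Rel (F := F) (c := c) (.aR (k := k) (s := s))
  bL := by simpa [E1, Be] using mk_eq_of_Rel (F := F) (c := c) (.bL (k := k) (s := s))
  bR := by simpa [E2, Be] using mk_eq_of_Rel (F := F) (c := c) (.bR (k := k) (s := s))
  gL := by simpa [E2, Ga] using mk_eq_of_Rel (F := F) (c := c) (.gL (k := k) (s := s))
  gR := by simpa [E1, Ga] using mk_eq_of_Rel (F := F) (c := c) (.gR (k := k) (s := s))
  hL := by simpa [E2, Et] using mk_eq_of_Rel (F := F) (c := c) (.hL (k := k) (s := s))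
  hR := by simpa [E2, Et] using mk_eq_of_Rel (F := F) (c := c) (.hR (k := k) (s := s))
  bh := by simpa [Be, Et] using mk_eq_of_Rel (F := F) (c := c) (.bh (k := k) (s := s))
  hg := by simpa [Et, Ga] using mk_eq_of_Rel (F := F) (c := c) (.hg (k := k) (s := s))
  gb := by simpa [Ga, Be] using mk_eq_of_Rel (F := F) (c := c) (.gb (k := k) (s := s))
  asq := by simpa [Al, Be, Ga] using mk_eq_of_Rel (F := F) (c := c) (.asq (k := k) (s := s))
  abg := by simpa [Al, Be, Ga] using mk_eq_of_Rel (F := F) (c := c) (.abg (k := k) (s := s))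
  hs := by simpa [Al, Be, Ga, Et] using mk_eq_of_Rel (F := F) (c := c) (.hs (k := k) (s := s))

theorem add_self_eq_zero_of_char_two (F : Type) [Field F] [CharP F 2] {A : Type} [Ring A]
    [Algebra F A] (x : A) : x + x = 0 := by
  rw [← two_smul F x, CharTwo.two_eq_zero, zero_smul]

section CommutatorSpace

variable {F : Type} [Field F] {A : Type} [Ring A] [Algebra F A]

theorem commutator_mem_Kspan (u v : A) : u * v - v * u ∈ Kspan F A :=
  Submodule.subset_span ⟨u, v, rfl⟩

theorem map_eq_zero_of_mem_Kspan {f : A →ₗ[F] F} (hf : ∀ u v, f (u * v) = f (v * u)) {x : A}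
    (hx : x ∈ Kspan F A) : f x = 0 := by
  have h : Kspan F A ≤ LinearMap.ker f := by
    refine Submodule.span_le.2 ?_
    rintro _ ⟨u, v, rfl⟩
    simp [hf u v]
  exact h hx

variable [CharP F 2]

theorem add_sq_sub_mem_Kspan (x y : A) : (x + y) ^ 2 - (x ^ 2 + y ^ 2) ∈ Kspan F A := by
  have h : (x + y) ^ 2 - (x ^ 2 + y ^ 2) = (x * y - y * x) + (y * x + y * x) := by noncomm_ring
  rw [h, add_self_eq_zero_of_char_two F, add_zero]
  exact commutator_mem_Kspan x y

variable (F A) in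
/-- The space `T₁(A) = {x : x² ∈ K(A)}` in characteristic two. -/
def T1sub : Submodule F A where
  carrier := {z | z ^ 2 ∈ Kspan F A}
  zero_mem' := by simp
  add_mem' {x y} hx hy := by
    have h := add_mem (add_sq_sub_mem_Kspan (F := F) x y) (add_mem hx hy)
    rwa [sub_add_cancel] at h
  smul_mem' r x hx := by
    simpa [smul_pow] using Submodule.smul_mem _ (r ^ 2) hx

theorem Kspan_le_T1sub : Kspan F A ≤ T1sub F A := by
  refine Submodule.span_le.2 ?_
  rintro _ ⟨u, v, rfl⟩
  have h : (u * v - v * u) ^ 2 = (u * (v * u * v) - (v * u * v) * u)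
      - (u * (v * v * u) - (v * v * u) * u) - (v * (u * u * v) - (u * u * v) * v)
      - ((v * v) * (u * u) - (u * u) * (v * v))
      + ((v * u * v * u + v * u * v * u) - (u * u * v * v + u * u * v * v)) := by noncomm_ring
  change (u * v - v * u) ^ 2 ∈ Kspan F A
  rw [h, add_self_eq_zero_of_char_two F, add_self_eq_zero_of_char_two F, sub_zero, add_zero]
  exact sub_mem (sub_mem (sub_mem (commutator_mem_Kspan _ _) (commutator_mem_Kspan _ _))
    (commutator_mem_Kspan _ _)) (commutator_mem_Kspan _ _)

end CommutatorSpace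

section Commutators

variable {F k s c}

theorem mem_Kspan_of_idem {A : Type} [Ring A] [Algebra F A] {e x : A} (h₁ : e * x = x)
    (h₂ : x * e = 0) : x ∈ Kspan F A := by
  simpa [h₁, h₂] using commutator_mem_Kspan (F := F) e x

theorem B12_eq_left {x : DA F k s c} (hx : x ∈ B12 F k s c) :
    E1 F k s c * x = x ∧ x * E1 F k s c = 0 := by
  have R := dRel_DA F k s c
  have hab (n : ℕ) : E1 F k s c * (ABG F k s c) ^ (n + 1) = (ABG F k s c) ^ (n + 1) := by
    rw [ABG, pow_succ', ← mul_assoc, ← mul_assoc, ← mul_assoc, R.aL]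
  have hbg (n : ℕ) : E1 F k s c * (BGA F k s c) ^ (n + 1) = (BGA F k s c) ^ (n + 1) := by
    rw [BGA, pow_succ', ← mul_assoc, ← mul_assoc, ← mul_assoc, R.bL]
  rcases hx with ((rfl | rfl) | ⟨i, hi, rfl⟩) | ⟨i, hi, rfl⟩
  · exact ⟨R.bL, R.b_e1⟩
  · simp [← mul_assoc, R.aL]; simp [mul_assoc, R.b_e1]
  · obtain ⟨n, rfl⟩ := Nat.exists_eq_add_of_le' hi.1
    simp [← mul_assoc, hbg]; simp [mul_assoc, R.b_e1]
  · obtain ⟨n, rfl⟩ := Nat.exists_eq_add_of_le' hi.1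
    simp [← mul_assoc, hab]; simp [mul_assoc, R.b_e1]

theorem B21_eq_left {x : DA F k s c} (hx : x ∈ B21 F k s c) :
    E2 F k s c * x = x ∧ x * E2 F k s c = 0 := by
  have R := dRel_DA F k s c
  have hga (n : ℕ) : E2 F k s c * (GAB F k s c) ^ (n + 1) = (GAB F k s c) ^ (n + 1) := by
    rw [GAB, pow_succ', ← mul_assoc, ← mul_assoc, ← mul_assoc, R.gL]
  rcases hx with ((rfl | rfl) | ⟨i, hi, rfl⟩) | ⟨i, hi, rfl⟩
  · exact ⟨R.gL, R.g_e2⟩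
  · simp [← mul_assoc, R.gL]; simp [mul_assoc, R.a_e2]
  · obtain ⟨n, rfl⟩ := Nat.exists_eq_add_of_le' hi.1
    simp [← mul_assoc, hga]; simp [mul_assoc, R.g_e2]
  · obtain ⟨n, rfl⟩ := Nat.exists_eq_add_of_le' hi.1
    simp [← mul_assoc, hga]; simp [mul_assoc, R.a_e2]

theorem ABG_pow_succ_eq (n : ℕ) : (ABG F k s c) ^ (n + 1)
    = Al F k s c * (Be F k s c * Ga F k s c * (ABG F k s c) ^ n) := by
  simp only [ABG, pow_succ', mul_assoc]

theorem BGA_pow_succ_eq (n : ℕ) : (BGA F k s c) ^ (n + 1)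
    = Be F k s c * Ga F k s c * (ABG F k s c) ^ n * Al F k s c := by
  rw [mul_assoc, ABG, DRel.abg_pow_mul_a, BGA, pow_succ', mul_assoc, mul_assoc, mul_assoc]

theorem KK_subset_Kspan [CharP F 2] (hk : 1 ≤ k) : KK F k s c ⊆ Kspan F (DA F k s c) := by
  have R := dRel_DA F k s c
  have hadd (u v : DA F k s c) : u * v + v * u ∈ Kspan F (DA F k s c) := by
    have h := commutator_mem_Kspan (F := F) u v
    rw [sub_eq_add_neg, neg_eq_of_add_eq_zero_left (add_self_eq_zero_of_char_two F (v * u))] at h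
    exact h
  have hzero {u v : DA F k s c} (h : v * u = 0) : u * v ∈ Kspan F (DA F k s c) := by
    simpa [h] using hadd u v
  rintro x (((hx | hx) | (((rfl | ⟨i, hi, rfl⟩) | ⟨i, hi, rfl⟩) | ⟨i, hi, rfl⟩)) | ⟨i, hi, rfl⟩)
  · exact mem_Kspan_of_idem (B12_eq_left hx).1 (B12_eq_left hx).2
  · exact mem_Kspan_of_idem (B21_eq_left hx).1 (B21_eq_left hx).2
  · exact hzero R.gb
  · obtain ⟨n, rfl⟩ := Nat.exists_eq_add_of_le' hi.1
    simp only [ABG_pow_succ_eq, BGA_pow_succ_eq]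
    exact hadd _ _
  · obtain ⟨n, rfl⟩ := Nat.exists_eq_add_of_le' hi.1
    have h : (BGA F k s c) ^ (n + 1) * Al F k s c = 0 := by
      rw [BGA, pow_succ, mul_assoc, mul_assoc (_ * _), mul_assoc _ _ (_ * _), R.g_mul_aa hk]
      simp
    simp only [ABG, DRel.abg_pow_mul_a]
    exact hzero h
  · simp only [← mul_assoc]
    refine hzero ?_
    rw [BGA, DRel.bga_pow_mul_b, ← mul_assoc, R.gb, zero_mul]
  · obtain ⟨n, rfl⟩ := Nat.exists_eq_add_of_le' hi.1
    have h₁ : (ABG F k s c) ^ (n + 1)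
        = (ABG F k s c) ^ n * (Al F k s c * Be F k s c) * Ga F k s c := by
      simp only [ABG, pow_succ, mul_assoc]
    have h₂ : (GAB F k s c) ^ (n + 1)
        = Ga F k s c * ((ABG F k s c) ^ n * (Al F k s c * Be F k s c)) := by
      rw [ABG, DRel.abg_pow_mul_ab, GAB, pow_succ']
      simp only [mul_assoc]
    simp only [h₁, h₂]
    exact hadd _ _

end Commutators

section Spanning

/-- The paths in the generators along the cycles `αβγ`, `βγα`, `γαβ` and `η`, without bounds on
their lengths. -/
def paths {A : Type} [Ring A] (e₁ e₂ a b g h : A) : Set A :=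
  {e₁, e₂} ∪ ⋃ n : ℕ, {(a * (b * g)) ^ n * (a * (b * g)), (a * (b * g)) ^ n * a,
    (a * (b * g)) ^ n * (a * b), (b * (g * a)) ^ n * (b * g), (b * (g * a)) ^ n * (b * (g * a)),
    (b * (g * a)) ^ n * b, (g * (a * b)) ^ n * g, (g * (a * b)) ^ n * (g * a),
    (g * (a * b)) ^ n * (g * (a * b)), h ^ n * h}

theorem DRel.paths_mul_mem {F A : Type} [Field F] [Ring A] [Algebra F A] {k s : ℕ} {c : F}
    {e₁ e₂ a b g h : A} (R : DRel k s c e₁ e₂ a b g h) (hk : 1 ≤ k) {x y : A}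
    (hx : x ∈ paths e₁ e₂ a b g h) (hy : y ∈ ({e₁, e₂, a, b, g, h} : Set A)) :
    x * y ∈ Submodule.span F (paths e₁ e₂ a b g h) := by
  set S := Submodule.span F (paths e₁ e₂ a b g h)
  have hcycle (n : ℕ) {z : A} (hz : z ∈ ({(a * (b * g)) ^ n * (a * (b * g)),
      (a * (b * g)) ^ n * a, (a * (b * g)) ^ n * (a * b), (b * (g * a)) ^ n * (b * g),
      (b * (g * a)) ^ n * (b * (g * a)), (b * (g * a)) ^ n * b, (g * (a * b)) ^ n * g,
      (g * (a * b)) ^ n * (g * a), (g * (a * b)) ^ n * (g * (a * b)), h ^ n * h} : Set A)) :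
      z ∈ S :=
    Submodule.subset_span (Or.inr (Set.mem_iUnion.2 ⟨n, hz⟩))
  have he₁ : e₁ ∈ S := Submodule.subset_span (by simp [paths])
  have he₂ : e₂ ∈ S := Submodule.subset_span (by simp [paths])
  have ha : a ∈ S := hcycle 0 (by simp)
  have hb : b ∈ S := hcycle 0 (by simp)
  have hg : g ∈ S := hcycle 0 (by simp)
  have hh : h ∈ S := hcycle 0 (by simp)
  have hasq : a * a = c • (a * (b * g)) ^ k := by rw [R.asq, mul_assoc]
  have hgk : g * (a * (b * g)) ^ k = 0 := by rw [← mul_assoc, R.g_mul_abg_pow hk]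
  have hak (n : ℕ) : (a * (b * g)) ^ n * (a * (b * g)) ^ k ∈ S := by
    obtain ⟨m, rfl⟩ := Nat.exists_eq_add_of_le' hk
    rw [← pow_add, ← add_assoc, pow_succ]
    exact hcycle (n + m) (Or.inl rfl)
  rcases hx with (rfl | rfl) | hx
  · rcases hy with rfl | rfl | rfl | rfl | rfl | rfl <;>
      simp [R.idem1, R.orth12, R.aL, R.bL, R.e1_g, R.e1_h, he₁, ha, hb]
  · rcases hy with rfl | rfl | rfl | rfl | rfl | rfl <;>
      simp [R.idem2, R.orth21, R.gL, R.hL, R.e2_a, R.e2_b, he₂, hg, hh]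
  obtain ⟨n, hx⟩ := Set.mem_iUnion.1 hx
  have hn {z : A} := hcycle n (z := z)
  have hn' {z : A} := hcycle (n + 1) (z := z)
  rcases hx with rfl | rfl | rfl | rfl | rfl | rfl | rfl | rfl | rfl | rfl <;>
  rcases hy with rfl | rfl | rfl | rfl | rfl | rfl <;>
  simp only [mul_assoc, R.aR, R.bR, R.gR, R.hR, R.a_e2, R.b_e1, R.g_e2, R.h_e1, R.a_g, R.a_h,
    R.b_a, R.b_b, R.g_g, R.g_h, R.h_a, R.h_b, R.bh, R.hg, R.gb, hasq, hgk, mul_zero, zero_mem,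
    smul_zero, mul_smul_comm] <;>
  first
  | (refine hn ?_; simp; done)
  | (refine hn' ?_; simp [pow_succ, mul_assoc]; done)
  | exact Submodule.smul_mem _ _ (hak n)

theorem span_paths_eq_top (hk : 1 ≤ k) : Submodule.span F (paths (E1 F k s c) (E2 F k s c)
    (Al F k s c) (Be F k s c) (Ga F k s c) (Et F k s c)) = ⊤ := by
  have R := dRel_DA F k s c
  set S := Submodule.span F (paths (E1 F k s c) (E2 F k s c)
    (Al F k s c) (Be F k s c) (Ga F k s c) (Et F k s c))
  have hgen (y : DA F k s c) (hy : y ∈ ({E1 F k s c, E2 F k s c, Al F k s c, Be F k s c,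
      Ga F k s c, Et F k s c} : Set (DA F k s c))) : S ≤ S.comap (LinearMap.mulRight F y) :=
    Submodule.span_le.2 fun x hx => R.paths_mul_mem hk hx hy
  have hmul (w : FreeAlgebra F Gen) : ∀ x ∈ S, x * mk F k s c w ∈ S := by
    induction w using FreeAlgebra.induction with
    | grade0 r =>
      intro x hx
      rw [AlgHom.commutes, ← Algebra.commutes, ← Algebra.smul_def]
      exact S.smul_mem _ hx
    | grade1 t =>
      intro x hx
      have ht : mk F k s c (gen F t) ∈ ({E1 F k s c, E2 F k s c, Al F k s c, Be F k s c,
          Ga F k s c, Et F k s c} : Set (DA F k s c)) := by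
        cases t <;> simp [E1, E2, Al, Be, Ga, Et]
      exact hgen _ ht hx
    | mul u v hu hv =>
      intro x hx
      rw [map_mul, ← mul_assoc]
      exact hv _ (hu _ hx)
    | add u v hu hv =>
      intro x hx
      rw [map_add, mul_add]
      exact S.add_mem (hu _ hx) (hv _ hx)
  have hone : (1 : DA F k s c) ∈ S := by
    rw [← R.unit]
    exact S.add_mem (Submodule.subset_span (by simp [paths]))
      (Submodule.subset_span (by simp [paths]))
  refine eq_top_iff.2 fun x _ => ?_
  obtain ⟨w, rfl⟩ : ∃ w, mk F k s c w = x := RingQuot.mkAlgHom_surjective F _ x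
  simpa using hmul w 1 hone

end Spanning

section Decomposition

variable {F k s c}

theorem BGA_pow_mul_Be_mem_KK {i : ℕ} (hi : i < k) :
    (BGA F k s c) ^ i * Be F k s c ∈ KK F k s c := by
  rcases Nat.eq_zero_or_pos i with rfl | h
  · simp [KK, B12]
  · exact .inl (.inl (.inl (.inl (.inr ⟨i, ⟨h, by omega⟩, rfl⟩))))

theorem ABG_pow_mul_AlBe_mem_KK {i : ℕ} (hi : i < k) :
    (ABG F k s c) ^ i * (Al F k s c * Be F k s c) ∈ KK F k s c := by
  rcases Nat.eq_zero_or_pos i with rfl | h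
  · simp [KK, B12]
  · exact .inl (.inl (.inl (.inr ⟨i, ⟨h, by omega⟩, rfl⟩)))

theorem GAB_pow_mul_Ga_mem_KK {i : ℕ} (hi : i < k) :
    (GAB F k s c) ^ i * Ga F k s c ∈ KK F k s c := by
  rcases Nat.eq_zero_or_pos i with rfl | h
  · simp [KK, B21]
  · exact .inl (.inl (.inr (.inl (.inr ⟨i, ⟨h, by omega⟩, rfl⟩))))

theorem GAB_pow_mul_GaAl_mem_KK {i : ℕ} (hi : i < k) :
    (GAB F k s c) ^ i * (Ga F k s c * Al F k s c) ∈ KK F k s c := by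
  rcases Nat.eq_zero_or_pos i with rfl | h
  · simp [KK, B21]
  · exact .inl (.inl (.inr (.inr ⟨i, ⟨h, by omega⟩, rfl⟩)))

theorem BGA_pow_mul_BeGa_mem_KK {i : ℕ} (hi : i < k) :
    (BGA F k s c) ^ i * (Be F k s c * Ga F k s c) ∈ KK F k s c := by
  rcases Nat.eq_zero_or_pos i with rfl | h
  · simp [KK, K11]
  · exact .inl (.inr (.inr ⟨i, ⟨h, by omega⟩, rfl⟩))

theorem ABG_pow_mul_Al_mem_KK {i : ℕ} (h : 1 ≤ i) (hi : i < k) :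
    (ABG F k s c) ^ i * Al F k s c ∈ KK F k s c :=
  .inl (.inr (.inl (.inr ⟨i, ⟨h, by omega⟩, rfl⟩)))

theorem ABG_add_BGA_mem_KK {i : ℕ} (h : 1 ≤ i) (hi : i < k) :
    (ABG F k s c) ^ i + (BGA F k s c) ^ i ∈ KK F k s c :=
  .inl (.inr (.inl (.inl (.inr ⟨i, ⟨h, by omega⟩, rfl⟩))))

theorem ABG_add_GAB_mem_KK {i : ℕ} (h : 1 ≤ i) (hi : i ≤ k) :
    (ABG F k s c) ^ i + (GAB F k s c) ^ i ∈ KK F k s c :=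
  .inr ⟨i, ⟨h, hi⟩, rfl⟩

theorem exists_eq_mod_KK (hk : 1 ≤ k) (hs : 1 ≤ s) (x : DA F k s c) :
    ∃ t ∈ Submodule.span F (KK F k s c), ∃ (p q r : F) (u v : ℕ → F),
      x = t + (p • E1 F k s c + q • E2 F k s c + r • Al F k s c)
        + ∑ i ∈ Finset.Icc 1 (k - 1), u i • (ABG F k s c) ^ i
        + ∑ j ∈ Finset.Icc 1 s, v j • (Et F k s c) ^ j := by
  have R := dRel_DA F k s c
  set KS := Submodule.span F (KK F k s c)
  set U : Submodule F (DA F k s c) := KS ⊔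
      Submodule.span F {E1 F k s c, E2 F k s c, Al F k s c} ⊔
      Submodule.span F ((fun i => (ABG F k s c) ^ i) '' (Finset.Icc 1 (k - 1) : Finset ℕ)) ⊔
      Submodule.span F ((fun j => (Et F k s c) ^ j) '' (Finset.Icc 1 s : Finset ℕ))
  have hKU {y : DA F k s c} (hy : y ∈ KK F k s c) : y ∈ U :=
    Submodule.mem_sup_left (Submodule.mem_sup_left (Submodule.mem_sup_left
      (Submodule.subset_span hy)))
  have hVU {y : DA F k s c} (hy : y ∈ ({E1 F k s c, E2 F k s c, Al F k s c} : Set (DA F k s c))) :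
      y ∈ U :=
    Submodule.mem_sup_left (Submodule.mem_sup_left (Submodule.mem_sup_right
      (Submodule.subset_span hy)))
  have hη (n : ℕ) : (Et F k s c) ^ (n + 1) ∈ U := by
    rcases lt_or_ge s (n + 1) with h | h
    · rw [R.h_pow_of_lt hk h]
      exact zero_mem _
    · exact Submodule.mem_sup_right (Submodule.subset_span ⟨n + 1, by simp [h], rfl⟩)
  have hω : (GAB F k s c) ^ k ∈ U := by
    obtain ⟨n, rfl⟩ := Nat.exists_eq_add_of_le' hs
    rw [GAB, ← R.hs]
    exact hη n
  have hABG (n : ℕ) : (ABG F k s c) ^ (n + 1) ∈ U := by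
    rcases lt_trichotomy (n + 1) k with h | h | h
    · exact Submodule.mem_sup_left (Submodule.mem_sup_right
        (Submodule.subset_span ⟨n + 1, by simp; omega, rfl⟩))
    · rw [h]
      exact (U.add_mem_iff_left hω).1 (hKU (ABG_add_GAB_mem_KK hk le_rfl))
    · rw [ABG, R.abg_pow_of_lt hk h]
      exact zero_mem _
  have hBGA (n : ℕ) : (BGA F k s c) ^ (n + 1) ∈ U := by
    rcases lt_trichotomy (n + 1) k with h | h | h
    · exact (U.add_mem_iff_right (hABG n)).1 (hKU (ABG_add_BGA_mem_KK (by omega) h))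
    · subst h
      rw [BGA, ← R.abg]
      exact hABG n
    · rw [BGA, R.bga_pow_of_lt hk h]
      exact zero_mem _
  have hGAB (n : ℕ) : (GAB F k s c) ^ (n + 1) ∈ U := by
    rcases le_or_gt (n + 1) k with h | h
    · exact (U.add_mem_iff_right (hABG n)).1 (hKU (ABG_add_GAB_mem_KK (by omega) h))
    · rw [GAB, R.gab_pow_of_lt hk h]
      exact zero_mem _
  have hBe (n : ℕ) : (BGA F k s c) ^ n * Be F k s c ∈ U := by
    rcases lt_or_ge n k with h | h
    · exact hKU (BGA_pow_mul_Be_mem_KK h)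
    · rw [BGA, R.bga_pow_mul_b_of_le hk h]
      exact zero_mem _
  have hBeGa (n : ℕ) : (BGA F k s c) ^ n * (Be F k s c * Ga F k s c) ∈ U := by
    rcases lt_or_ge n k with h | h
    · exact hKU (BGA_pow_mul_BeGa_mem_KK h)
    · rw [BGA, ← mul_assoc, R.bga_pow_mul_b_of_le hk h, zero_mul]
      exact zero_mem _
  have hGa (n : ℕ) : (GAB F k s c) ^ n * Ga F k s c ∈ U := by
    rcases lt_or_ge n k with h | h
    · exact hKU (GAB_pow_mul_Ga_mem_KK h)
    · rw [GAB, R.gab_pow_mul_g_of_le hk h]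
      exact zero_mem _
  have hGaAl (n : ℕ) : (GAB F k s c) ^ n * (Ga F k s c * Al F k s c) ∈ U := by
    rcases lt_or_ge n k with h | h
    · exact hKU (GAB_pow_mul_GaAl_mem_KK h)
    · rw [GAB, ← mul_assoc, R.gab_pow_mul_g_of_le hk h, zero_mul]
      exact zero_mem _
  have hAl (n : ℕ) : (ABG F k s c) ^ n * Al F k s c ∈ U := by
    rcases Nat.eq_zero_or_pos n with rfl | hn
    · exact hVU (by simp)
    rcases lt_or_ge n k with h | h
    · exact hKU (ABG_pow_mul_Al_mem_KK hn h)
    · rw [ABG, R.abg_pow_mul_a_of_le hk h]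
      exact zero_mem _
  have hAlBe (n : ℕ) : (ABG F k s c) ^ n * (Al F k s c * Be F k s c) ∈ U := by
    rcases lt_or_ge n k with h | h
    · exact hKU (ABG_pow_mul_AlBe_mem_KK h)
    · rw [ABG, ← mul_assoc, R.abg_pow_mul_a_of_le hk h, zero_mul]
      exact zero_mem _
  have hUtop : U = ⊤ := by
    rw [eq_top_iff, ← span_paths_eq_top F k s c hk, Submodule.span_le]
    simp only [ABG, BGA, GAB, pow_succ, mul_assoc]
      at hη hABG hBGA hGAB hBe hBeGa hGa hGaAl hAl hAlBe
    rintro y ((rfl | rfl) | hy)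
    · exact hVU (by simp)
    · exact hVU (by simp)
    obtain ⟨n, rfl | rfl | rfl | rfl | rfl | rfl | rfl | rfl | rfl | rfl⟩ := Set.mem_iUnion.1 hy
    exacts [hABG n, hAl n, hAlBe n, hBeGa n, hBGA n, hBe n, hGa n, hGaAl n, hGAB n, hη n]
  have hx : x ∈ U := hUtop ▸ Submodule.mem_top
  obtain ⟨x₁, h₁, w, hw, rfl⟩ := Submodule.mem_sup.1 hx
  obtain ⟨x₂, h₂, z, hz, rfl⟩ := Submodule.mem_sup.1 h₁
  obtain ⟨t, ht, y, hy, rfl⟩ := Submodule.mem_sup.1 h₂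
  obtain ⟨v, rfl⟩ := (Submodule.mem_span_image_finset_iff_exists_fun' F).1 hw
  obtain ⟨u, rfl⟩ := (Submodule.mem_span_image_finset_iff_exists_fun' F).1 hz
  obtain ⟨p, q, r, rfl⟩ := Submodule.mem_span_triple.1 hy
  exact ⟨t, ht, p, q, r, u, v, rfl⟩

end Decomposition

section Functionals

open Polynomial

/-- A polynomial model whose quotient by the radical of a trace form is the algebra. -/
abbrev Model : Type := Matrix (Fin 3) (Fin 3) F[X] × F[X] × F[X]

variable {F} in
/-- A matrix unit with polynomial coefficient. -/
abbrev munit (i j : Fin 3) (f : F[X]) : Model F := (Matrix.single i j f, 0, 0)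

variable {F} in
theorem munit_mul_munit (i j l m : Fin 3) (f g : F[X]) :
    munit i j f * munit l m g = if j = l then munit i m (f * g) else 0 := by
  split_ifs with h
  · subst h; simp [munit]
  · simp [munit, h]

/-- The images of the generators in the model. -/
def genModel : Gen → Model F
  | .e1 => (Matrix.single 0 0 1 + Matrix.single 1 1 1, 0, 1)
  | .e2 => (Matrix.single 2 2 1, 1, 0)
  | .a => (Matrix.single 0 1 1, 0, X)
  | .b => munit 1 2 1
  | .g => munit 2 0 X
  | .h => (0, X, 0)

/-- The evaluation of free algebra elements in the model. -/
def toModel : FreeAlgebra F Gen →ₐ[F] Model F := FreeAlgebra.lift F (genModel F)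

@[simp] theorem toModel_gen (t : Gen) : toModel F (gen F t) = genModel F t := by
  simp [toModel, gen]

/-- The order inside the model generated by the algebra. -/
def order : Subalgebra F (Model F) where
  carrier := {Z | (Z.1 1 0).coeff 0 = 0 ∧ (Z.1 2 0).coeff 0 = 0 ∧ (Z.1 2 1).coeff 0 = 0 ∧
    (Z.1 0 0).coeff 0 = Z.2.2.coeff 0 ∧ (Z.1 1 1).coeff 0 = Z.2.2.coeff 0 ∧
    (Z.1 2 2).coeff 0 = Z.2.1.coeff 0}
  mul_mem' := by
    rintro ⟨A, y, z⟩ ⟨B, y', z'⟩ ⟨h₁, h₂, h₃, h₄, h₅, h₆⟩ ⟨g₁, g₂, g₃, g₄, g₅, g₆⟩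
    simp_all [Matrix.mul_apply, Fin.sum_univ_three, mul_coeff_zero]
  add_mem' := by
    rintro ⟨A, y, z⟩ ⟨B, y', z'⟩ ⟨h₁, h₂, h₃, h₄, h₅, h₆⟩ ⟨g₁, g₂, g₃, g₄, g₅, g₆⟩
    simp_all
  algebraMap_mem' r := by
    simp [Matrix.algebraMap_matrix_apply, Prod.algebraMap_apply]

variable {F} in
theorem mem_order_iff {Z : Model F} : Z ∈ order F ↔
    (Z.1 1 0).coeff 0 = 0 ∧ (Z.1 2 0).coeff 0 = 0 ∧ (Z.1 2 1).coeff 0 = 0 ∧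
    (Z.1 0 0).coeff 0 = Z.2.2.coeff 0 ∧ (Z.1 1 1).coeff 0 = Z.2.2.coeff 0 ∧
    (Z.1 2 2).coeff 0 = Z.2.1.coeff 0 := Iff.rfl

theorem toModel_mem_order (w : FreeAlgebra F Gen) : toModel F w ∈ order F := by
  induction w using FreeAlgebra.induction with
  | grade0 r => exact (toModel F).commutes r ▸ (order F).algebraMap_mem r
  | grade1 t =>
    change toModel F (gen F t) ∈ order F
    cases t <;> simp [genModel, mem_order_iff]
  | mul x y hx hy => exact map_mul (toModel F) x y ▸ mul_mem hx hy
  | add x y hx hy => exact map_add (toModel F) x y ▸ add_mem hx hy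

/-- The trace form on the model. -/
def modelTrace : Model F →ₗ[F] F :=
  LinearMap.coprod (lcoeff F k ∘ₗ Matrix.traceLinearMap (Fin 3) F F[X])
    (LinearMap.coprod (lcoeff F s) (c • lcoeff F 2))

variable {F k s c}

theorem modelTrace_apply (Z : Model F) :
    modelTrace F k s c Z = Z.1.trace.coeff k + (Z.2.1.coeff s + c * Z.2.2.coeff 2) := by
  simp [modelTrace]

theorem modelTrace_mul_comm (Y Z : Model F) :
    modelTrace F k s c (Y * Z) = modelTrace F k s c (Z * Y) := by
  simp only [modelTrace_apply, Prod.fst_mul, Prod.snd_mul, Matrix.trace_mul_comm Y.1,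
    mul_comm Y.2.1, mul_comm Y.2.2]

theorem munit_pow (i : Fin 3) (f : F[X]) {n : ℕ} (hn : 1 ≤ n) :
    munit i i f ^ n = munit i i (f ^ n) := by
  induction n, hn using Nat.le_induction with
  | base => simp
  | succ n hn ih => rw [pow_succ, ih, munit_mul_munit, if_pos rfl, pow_succ]

variable (F) in
theorem toModel_abg :
    toModel F (gen F .a * gen F .b * gen F .g) = munit 0 0 X := by
  simp [genModel]

variable (F) in
theorem toModel_bga :
    toModel F (gen F .b * gen F .g * gen F .a) = munit 1 1 X := by
  simp [genModel]

variable (F) in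
theorem toModel_gab :
    toModel F (gen F .g * gen F .a * gen F .b) = munit 2 2 X := by
  simp [genModel]

theorem modelTrace_munit_mul (i j : Fin 3) (f : F[X]) (Z : Model F) :
    modelTrace F k s c (munit i j f * Z) = (f * Z.1 j i).coeff k := by
  simp [modelTrace_apply, munit, Matrix.trace_single_mul]

theorem genModel_sum : genModel F .e1 + genModel F .e2 = 1 := by
  have h : Matrix.single 0 0 1 + Matrix.single 1 1 1 + Matrix.single 2 2 1
      = (1 : Matrix (Fin 3) (Fin 3) F[X]) := by
    ext1 i j
    fin_cases i <;> fin_cases j <;> simp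
  simp [genModel, h, Prod.ext_iff]

theorem modelTrace_rel (hk : 1 ≤ k) (hs : 1 ≤ s) {x y : FreeAlgebra F Gen}
    (h : Rel F k s c x y) {Z : Model F} (hZ : Z ∈ order F) :
    modelTrace F k s c (toModel F x * Z) = modelTrace F k s c (toModel F y * Z) := by
  obtain ⟨h₁, h₂, h₃, h₄, h₅, h₆⟩ := mem_order_iff.1 hZ
  have key {p q : FreeAlgebra F Gen} (hpq : toModel F p = toModel F q) :
      modelTrace F k s c (toModel F p * Z) = modelTrace F k s c (toModel F q * Z) := by
    rw [hpq]
  induction h with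
  | asq =>
    have h : genModel F .a * genModel F .a = ((0, 0, X ^ 2) : Model F) := by
      simp [genModel, sq]
    rw [map_mul (toModel F), map_smul (toModel F), map_pow (toModel F), toModel_abg,
      munit_pow _ _ hk, smul_mul_assoc, map_smul, modelTrace_munit_mul, toModel_gen, h]
    simp [modelTrace_apply, h₄, coeff_X_pow_mul']
  | abg =>
    rw [map_pow (toModel F), map_pow (toModel F), toModel_abg, toModel_bga, munit_pow _ _ hk,
      munit_pow _ _ hk, modelTrace_munit_mul, modelTrace_munit_mul]
    simp [h₄, h₅, coeff_X_pow_mul']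
  | hs =>
    have h : genModel F .h ^ s = ((0, X ^ s, 0) : Model F) := by
      simp [genModel, Prod.pow_mk, Nat.one_le_iff_ne_zero.1 hs]
    rw [map_pow (toModel F), map_pow (toModel F), toModel_gab, munit_pow _ _ hk,
      modelTrace_munit_mul, toModel_gen, h]
    simp [modelTrace_apply, h₆, coeff_X_pow_mul']
  | unit => exact key (by simp [genModel_sum])
  | _ => exact key (by simp [genModel, add_mul, mul_add])

variable (F k s c) in
/-- The congruence on the free algebra given by the radical of the trace form on the order. -/
def traceCon : RingCon (FreeAlgebra F Gen) where
  r x y := ∀ Z ∈ order F,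
    modelTrace F k s c (toModel F x * Z) = modelTrace F k s c (toModel F y * Z)
  iseqv := ⟨fun _ _ _ => rfl, fun h Z hZ => (h Z hZ).symm, fun h g Z hZ => (h Z hZ).trans (g Z hZ)⟩
  add' h g Z hZ := by
    rw [map_add (toModel F), map_add (toModel F), add_mul, add_mul, map_add, map_add, h Z hZ,
      g Z hZ]
  mul' {x x' y y'} h g Z hZ := by
    rw [map_mul (toModel F), map_mul (toModel F), mul_assoc,
      h _ (mul_mem (toModel_mem_order F y) hZ), ← mul_assoc, mul_assoc, modelTrace_mul_comm,
      mul_assoc, g _ (mul_mem hZ (toModel_mem_order F x')), ← mul_assoc, modelTrace_mul_comm,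
      ← mul_assoc]

theorem modelTrace_eq_of_mk_eq (hk : 1 ≤ k) (hs : 1 ≤ s) {x y : FreeAlgebra F Gen}
    (h : mk F k s c x = mk F k s c y) {Z : Model F} (hZ : Z ∈ order F) :
    modelTrace F k s c (toModel F x * Z) = modelTrace F k s c (toModel F y * Z) := by
  have hrel : ∀ ⦃p q⦄, Rel F k s c p q →
      (traceCon F k s c).mkₐ F p = (traceCon F k s c).mkₐ F q := fun p q hpq =>
    (traceCon F k s c).eq.2 fun Z hZ => modelTrace_rel hk hs hpq hZ
  have hlift := congrArg (RingQuot.liftAlgHom F ⟨(traceCon F k s c).mkₐ F, hrel⟩) h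
  simp only [mk] at hlift
  erw [RingQuot.liftAlgHom_mkAlgHom_apply, RingQuot.liftAlgHom_mkAlgHom_apply] at hlift
  exact (traceCon F k s c).eq.1 hlift Z hZ

theorem mk_surjective : Function.Surjective (mk F k s c) :=
  RingQuot.mkAlgHom_surjective F (Rel F k s c)

/-- The functional on the algebra induced by an element of the model. -/
theorem exists_functional (hk : 1 ≤ k) (hs : 1 ≤ s) {Z : Model F} (hZ : Z ∈ order F) :
    ∃ f : DA F k s c →ₗ[F] F, ∀ w, f (mk F k s c w) = modelTrace F k s c (toModel F w * Z) := by
  obtain ⟨g, hg⟩ := (mk F k s c).toLinearMap.exists_rightInverse_of_surjective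
    (LinearMap.range_eq_top.2 mk_surjective)
  refine ⟨modelTrace F k s c ∘ₗ LinearMap.mulRight F Z ∘ₗ (toModel F).toLinearMap ∘ₗ g,
    fun w => modelTrace_eq_of_mk_eq hk hs ?_ hZ⟩
  exact LinearMap.congr_fun hg (mk F k s c w)

end Functionals

section Independence

open Polynomial

/-- Labels for the elements of the basis of `T₁`. -/
inductive Label : Type
  | off (p q : Fin 3) (i : ℕ) | d1 (i : ℕ) | d2 (i : ℕ) | dk | top (i : ℕ) | eta (j : ℕ)
  | etas | n1 | n2

/-- Paths in the free algebra whose image in the model is an off-diagonal matrix unit. -/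
def offWord (i : ℕ) : Fin 3 → Fin 3 → FreeAlgebra F Gen
  | 0, 1 => (gen F .a * gen F .b * gen F .g) ^ i * gen F .a
  | 0, 2 => (gen F .a * gen F .b * gen F .g) ^ i * (gen F .a * gen F .b)
  | 1, 2 => (gen F .b * gen F .g * gen F .a) ^ i * gen F .b
  | 1, 0 => (gen F .b * gen F .g * gen F .a) ^ (i - 1) * (gen F .b * gen F .g)
  | 2, 0 => (gen F .g * gen F .a * gen F .b) ^ (i - 1) * gen F .g
  | 2, 1 => (gen F .g * gen F .a * gen F .b) ^ (i - 1) * (gen F .g * gen F .a)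
  | _, _ => 0

variable {F}

theorem toModel_pow_mul {w x : FreeAlgebra F Gen} {p q : Fin 3} {f : F[X]}
    (hw : toModel F w = munit p p X) (hx : toModel F x = munit p q f) (n : ℕ) :
    toModel F (w ^ n * x) = munit p q (X ^ n * f) := by
  induction n with
  | zero => simp [hx]
  | succ n ih =>
    rw [pow_succ', mul_assoc, map_mul (toModel F), hw, ih, munit_mul_munit, if_pos rfl, pow_succ',
      mul_assoc]

theorem toModel_offWord {i : ℕ} {p q : Fin 3} (hpq : p ≠ q) (h : q < p → 1 ≤ i)
    (h' : ¬(p = 0 ∧ q = 1 ∧ i = 0)) : toModel F (offWord F i p q) = munit p q (X ^ i) := by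
  have hsub (hi : 1 ≤ i) : (X : F[X]) ^ (i - 1) * X = X ^ i := by
    rw [← pow_succ, Nat.sub_add_cancel hi]
  fin_cases p <;> fin_cases q
  any_goals exact absurd rfl hpq
  · obtain ⟨n, rfl⟩ :=
      Nat.exists_eq_add_of_le' (Nat.one_le_iff_ne_zero.2 fun hi => h' ⟨rfl, rfl, hi⟩)
    change toModel F ((gen F .a * gen F .b * gen F .g) ^ (n + 1) * gen F .a) = _
    rw [map_mul (toModel F), map_pow, toModel_abg, munit_pow _ _ (Nat.le_add_left 1 n)]
    simp [genModel]
  · exact (toModel_pow_mul (toModel_abg F) (q := 2) (f := 1) (by simp [genModel]) i).trans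
      (by rw [mul_one]; rfl)
  · exact (toModel_pow_mul (toModel_bga F) (q := 0) (f := X) (by simp [genModel]) (i - 1)).trans
      (by rw [hsub (h (by decide))]; rfl)
  · exact (toModel_pow_mul (toModel_bga F) (q := 2) (f := 1) (by simp [genModel]) i).trans
      (by rw [mul_one]; rfl)
  · exact (toModel_pow_mul (toModel_gab F) (q := 0) (f := X) (by simp [genModel]) (i - 1)).trans
      (by rw [hsub (h (by decide))]; rfl)
  · exact (toModel_pow_mul (toModel_gab F) (q := 1) (f := X) (by simp [genModel]) (i - 1)).trans
      (by rw [hsub (h (by decide))]; rfl)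

theorem toModel_pow {w : FreeAlgebra F Gen} {p : Fin 3} (hw : toModel F w = munit p p X) {n : ℕ}
    (hn : 1 ≤ n) : toModel F (w ^ n) = munit p p (X ^ n) := by
  rw [map_pow, hw, munit_pow _ _ hn]

theorem toModel_h_pow {n : ℕ} (hn : 1 ≤ n) : toModel F (gen F .h ^ n) = (0, X ^ n, 0) := by
  rw [map_pow, toModel_gen]
  simp [genModel, Prod.pow_mk, Nat.one_le_iff_ne_zero.1 hn]

/-- The free algebra element attached to a label; `u` and `v` are the coefficients of the
correction terms of the loop `α`. -/
def word (u v : F) : Label → FreeAlgebra F Gen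
  | .off p q i => offWord F i p q
  | .d1 i => (gen F .a * gen F .b * gen F .g) ^ i + (gen F .b * gen F .g * gen F .a) ^ i
  | .d2 i => (gen F .a * gen F .b * gen F .g) ^ i + (gen F .g * gen F .a * gen F .b) ^ i
  | .dk => (gen F .a * gen F .b * gen F .g) ^ k + (gen F .g * gen F .a * gen F .b) ^ k
  | .top i => (gen F .a * gen F .b * gen F .g) ^ i
  | .eta j => gen F .h ^ j
  | .etas => gen F .h ^ s
  | .n1 => gen F .a + u • (gen F .a * gen F .b * gen F .g) ^ (k / 2) + v • gen F .h ^ (s / 2)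
  | .n2 => (gen F .a * gen F .b * gen F .g) ^ (k / 2) + gen F .h ^ (s / 2)

/-- The range of the labels. -/
def Valid (v : F) : Label → Prop
  | .off p q i => p ≠ q ∧ (q < p → 1 ≤ i) ∧ ¬(p = 0 ∧ q = 1 ∧ i = 0) ∧ i ≤ k ∧ (p < q → i < k)
  | .d1 i | .d2 i => 1 ≤ i ∧ i < k
  | .top i => (k + 2) / 2 ≤ i ∧ i < k
  | .eta j => (s + 2) / 2 ≤ j ∧ j < s
  | .n2 => v = 0 ∧ 2 ≤ k ∧ 2 ≤ s
  | .dk | .etas | .n1 => True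

/-- The images of the labelled elements in the model. -/
def value (u v : F) : Label → Model F
  | .off p q i => munit p q (X ^ i)
  | .d1 i => munit 0 0 (X ^ i) + munit 1 1 (X ^ i)
  | .d2 i => munit 0 0 (X ^ i) + munit 2 2 (X ^ i)
  | .dk => munit 0 0 (X ^ k) + munit 2 2 (X ^ k)
  | .top i => munit 0 0 (X ^ i)
  | .eta j => (0, X ^ j, 0)
  | .etas => (0, X ^ s, 0)
  | .n1 => (Matrix.single 0 1 1, 0, X) + u • munit 0 0 (X ^ (k / 2)) + v • (0, X ^ (s / 2), 0)
  | .n2 => (Matrix.single 0 0 (X ^ (k / 2)), X ^ (s / 2), 0)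

variable (F) in
/-- The elements of the order representing the dual functionals. -/
def dualElt : Label → Model F
  | .off p q i => munit q p (X ^ (k - i))
  | .d1 i => munit 1 1 (X ^ (k - i))
  | .d2 i => munit 2 2 (X ^ (k - i))
  | .dk => genModel F .e1
  | .top i => ((X ^ (k - i) : F[X]) • (1 : Matrix (Fin 3) (Fin 3) F[X]), 0, 0)
  | .eta j => (0, X ^ (s - j), 0)
  | .etas => 1
  | .n1 => munit 1 0 (X ^ k)
  | .n2 => (0, X ^ (s - s / 2), 0)

variable {k s c}

theorem toModel_word (hk : 1 ≤ k) (hs : 1 ≤ s) {u v : F} (hu : u ≠ 0 → 2 ≤ k) (hv : v ≠ 0 → 2 ≤ s)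
    {x : Label} (hx : Valid k s v x) : toModel F (word k s u v x) = value k s u v x := by
  have hu' : u • toModel F ((gen F .a * gen F .b * gen F .g) ^ (k / 2))
      = u • munit 0 0 (X ^ (k / 2)) := by
    rcases eq_or_ne u 0 with rfl | h
    · simp
    · rw [toModel_pow (toModel_abg F) (by have := hu h; omega)]
  have hv' : v • toModel F (gen F .h ^ (s / 2)) = v • ((0, X ^ (s / 2), 0) : Model F) := by
    rcases eq_or_ne v 0 with rfl | h
    · simp
    · rw [toModel_h_pow (by have := hv h; omega)]
  cases x with
  | off p q i => exact toModel_offWord hx.1 hx.2.1 hx.2.2.1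
  | d1 i =>
    rw [word, map_add, toModel_pow (toModel_abg F) hx.1, toModel_pow (toModel_bga F) hx.1, value]
  | d2 i =>
    rw [word, map_add, toModel_pow (toModel_abg F) hx.1, toModel_pow (toModel_gab F) hx.1, value]
  | dk => rw [word, map_add, toModel_pow (toModel_abg F) hk, toModel_pow (toModel_gab F) hk, value]
  | top i => exact toModel_pow (toModel_abg F) (by have := hx.1; omega)
  | eta j => exact toModel_h_pow (by have := hx.1; omega)
  | etas => exact toModel_h_pow hs
  | n1 => rw [word, map_add, map_add, map_smul, map_smul, hu', hv', toModel_gen, genModel, value]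
  | n2 =>
    rw [word, map_add, toModel_pow (toModel_abg F) (by have := hx.2.1; omega),
      toModel_h_pow (by have := hx.2.2; omega), value]
    simp

theorem dualElt_mem_order (hk : 1 ≤ k) {v : F} {x : Label} (hx : Valid k s v x) :
    dualElt F k s x ∈ order F := by
  cases x with
  | off p q i =>
    obtain ⟨h₁, h₂, h₃, h₄, h₅⟩ := hx
    fin_cases p <;> fin_cases q <;>
      simp [dualElt, mem_order_iff, coeff_X_pow] at h₁ h₂ h₃ h₅ ⊢ <;> omega
  | dk => simp [dualElt, mem_order_iff, genModel]
  | etas => exact one_mem _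
  | n1 => simp [dualElt, mem_order_iff, coeff_X_pow]; omega
  | n2 => simp [dualElt, mem_order_iff, coeff_X_pow]; have := hx.2.2; omega
  | _ =>
    obtain ⟨h₁, h₂⟩ := hx
    simp [dualElt, mem_order_iff, coeff_X_pow]
    omega

variable (k s c) in
/-- The linear functional on the model represented by `dualElt`. -/
def coord (Z : Model F) : Label → F
  | .off p q i => (Z.1 p q).coeff i
  | .d1 i => (Z.1 1 1).coeff i
  | .d2 i => (Z.1 2 2).coeff i
  | .dk => (Z.1 0 0).coeff k + (Z.1 1 1).coeff k + c * Z.2.2.coeff 2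
  | .top i => (Z.1 0 0).coeff i + (Z.1 1 1).coeff i + (Z.1 2 2).coeff i
  | .eta j => Z.2.1.coeff j
  | .etas => (Z.1 0 0).coeff k + (Z.1 1 1).coeff k + (Z.1 2 2).coeff k
      + (Z.2.1.coeff s + c * Z.2.2.coeff 2)
  | .n1 => (Z.1 0 1).coeff 0
  | .n2 => Z.2.1.coeff (s / 2)

theorem modelTrace_mul_dualElt {v : F} {x : Label} (hx : Valid k s v x) (Z : Model F) :
    modelTrace F k s c (Z * dualElt F k s x) = coord k s c Z x := by
  have h {n i : ℕ} (hi : i ≤ n) (f : F[X]) : (f * X ^ (n - i)).coeff n = f.coeff i := by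
    rw [coeff_mul_X_pow', if_pos (by omega), Nat.sub_sub_self hi]
  cases x with
  | off p q i =>
    rw [modelTrace_mul_comm, dualElt, modelTrace_munit_mul, mul_comm, h hx.2.2.2.1, coord]
  | d1 i => rw [modelTrace_mul_comm, dualElt, modelTrace_munit_mul, mul_comm, h hx.2.le, coord]
  | d2 i => rw [modelTrace_mul_comm, dualElt, modelTrace_munit_mul, mul_comm, h hx.2.le, coord]
  | n1 =>
    rw [modelTrace_mul_comm, dualElt, modelTrace_munit_mul, coord]
    simp [coeff_X_pow_mul']
  | etas => simp [dualElt, modelTrace_apply, coord, Matrix.trace, Fin.sum_univ_three]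
  | top i =>
    simp [dualElt, modelTrace_apply, coord, Matrix.trace, Fin.sum_univ_three,
      mul_comm _ (X ^ _), ← h hx.2.le]
  | eta i => simp [dualElt, modelTrace_apply, coord, h hx.2.le]
  | n2 => simp [dualElt, modelTrace_apply, coord, h (Nat.div_le_self s 2)]
  | dk =>
    simp [dualElt, modelTrace_apply, coord, Matrix.trace, Fin.sum_univ_three, genModel, mul_add,
      Matrix.mul_apply]

theorem coord_value_self (hk : 1 ≤ k) (hs : 1 ≤ s) {u v : F} (x : Label) :
    coord k s c (value k s u v x) x = 1 := by
  have h₁ : ¬ k ≤ k / 2 := by omega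
  have h₂ : ¬ s ≤ s / 2 := by omega
  cases x <;> simp [coord, value, coeff_X_pow]

theorem coord_value_of_ne [CharP F 2] (hk : 1 ≤ k) (hs : 1 ≤ s) {u v : F} {x y : Label}
    (hx : Valid k s v x) (hy : Valid k s v y) (hxy : x ≠ y) :
    coord k s c (value k s u v y) x = 0 := by
  have h₁ : k ≠ k / 2 := by omega
  have h₂ : s ≠ s / 2 := by omega
  have h2 : (1 : F) + 1 = 0 := CharTwo.add_self_eq_zero 1
  have hite (P : Prop) [Decidable P] (f : F[X]) (n : ℕ) :
      (if P then f else 0).coeff n = if P then f.coeff n else 0 := by split_ifs <;> simp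
  cases x <;> cases y <;>
    simp_all [coord, value, coeff_X_pow, Matrix.single_apply, Valid, coeff_X, coeff_one] <;> grind

end Independence

section Basis

variable {F k s c}

theorem mk_abg : mk F k s c (gen F .a * gen F .b * gen F .g) = ABG F k s c := by
  rw [map_mul, map_mul]
  rfl

theorem mk_bga : mk F k s c (gen F .b * gen F .g * gen F .a) = BGA F k s c := by
  rw [map_mul, map_mul]
  rfl

theorem mk_gab : mk F k s c (gen F .g * gen F .a * gen F .b) = GAB F k s c := by
  rw [map_mul, map_mul]
  rfl

theorem mk_pow_mul {w x : FreeAlgebra F Gen} {y z : DA F k s c} (hw : mk F k s c w = y)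
    (hx : mk F k s c x = z) (i : ℕ) : mk F k s c (w ^ i * x) = y ^ i * z := by
  rw [map_mul, map_pow, hw, hx]

/-- The elements of the algebra attached to the valid labels. -/
def wordSet (F : Type) [Field F] (k s : ℕ) (c u v : F) : Set (DA F k s c) :=
  Set.range fun x : {x // Valid k s v x} => mk F k s c (word k s u v x)

theorem linearIndepOn_wordSet [CharP F 2] (hk : 1 ≤ k) (hs : 1 ≤ s) {u v : F}
    (hu : u ≠ 0 → 2 ≤ k) (hv : v ≠ 0 → 2 ≤ s) : LinearIndepOn F id (wordSet F k s c u v) := by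
  choose f hf using fun x : {x // Valid k s v x} =>
    exists_functional (F := F) (c := c) hk hs (dualElt_mem_order (F := F) hk x.2)
  have key (x y : {x // Valid k s v x}) :
      f x (mk F k s c (word k s u v y)) = coord k s c (value k s u v y) x := by
    rw [hf, toModel_word hk hs hu hv y.2, modelTrace_mul_dualElt x.2]
  refine LinearIndependent.linearIndepOn_id (LinearIndependent.of_pairwise_dual_eq_zero_one _ f
    (fun x y hxy => ?_) fun x => ?_)
  · change f x _ = 0
    rw [key]
    exact coord_value_of_ne hk hs x.2 y.2 (Subtype.coe_injective.ne hxy)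
  · rw [key]
    exact coord_value_self hk hs x.1

theorem mem_wordSet {u v : F} {x : Label} (hx : Valid k s v x) {y : DA F k s c}
    (h : mk F k s c (word k s u v x) = y) : y ∈ wordSet F k s c u v :=
  ⟨⟨x, hx⟩, h⟩

theorem KK_subset_wordSet (hk : 1 ≤ k) (u v : F) : KK F k s c ⊆ wordSet F k s c u v := by
  have hoff {p q : Fin 3} {i : ℕ} {w : FreeAlgebra F Gen} {y : DA F k s c} (hy : mk F k s c w = y)
      (hw : offWord F i p q = w) (h : Valid k s v (.off p q i)) : y ∈ wordSet F k s c u v :=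
    mem_wordSet h ((congrArg _ hw).trans hy)
  rintro _ (((((((rfl | rfl) | ⟨i, ⟨h₁, h₂⟩, rfl⟩) | ⟨i, ⟨h₁, h₂⟩, rfl⟩)) |
    (((rfl | rfl) | ⟨i, ⟨h₁, h₂⟩, rfl⟩) | ⟨i, ⟨h₁, h₂⟩, rfl⟩)) |
    (((rfl | ⟨i, ⟨h₁, h₂⟩, rfl⟩) | ⟨i, ⟨h₁, h₂⟩, rfl⟩) | ⟨i, ⟨h₁, h₂⟩, rfl⟩)) |
    ⟨i, ⟨h₁, h₂⟩, rfl⟩)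
  · exact hoff (p := 1) (q := 2) (i := 0) rfl (one_mul _) (by simp [Valid]; omega)
  · exact hoff (p := 0) (q := 2) (i := 0) (map_mul _ _ _) (one_mul _) (by simp [Valid]; omega)
  · exact hoff (p := 1) (q := 2) (i := i) (mk_pow_mul mk_bga rfl i) rfl
      (by simp [Valid]; omega)
  · exact hoff (p := 0) (q := 2) (i := i) (mk_pow_mul mk_abg (map_mul _ _ _) i) rfl
      (by simp [Valid]; omega)
  · exact hoff (p := 2) (q := 0) (i := 1) rfl (one_mul _) (by simp [Valid]; omega)
  · exact hoff (p := 2) (q := 1) (i := 1) (map_mul _ _ _) (one_mul _) (by simp [Valid]; omega)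
  · exact hoff (p := 2) (q := 0) (i := i + 1) (mk_pow_mul mk_gab rfl i) rfl
      (by simp [Valid]; omega)
  · exact hoff (p := 2) (q := 1) (i := i + 1) (mk_pow_mul mk_gab (map_mul _ _ _) i) rfl
      (by simp [Valid]; omega)
  · exact hoff (p := 1) (q := 0) (i := 1) (map_mul _ _ _) (one_mul _) (by simp [Valid]; omega)
  · exact mem_wordSet (x := .d1 i) ⟨h₁, by omega⟩
      (by rw [word, map_add, map_pow, map_pow, mk_abg, mk_bga])
  · exact hoff (p := 0) (q := 1) (i := i) (mk_pow_mul mk_abg rfl i) rfl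
      (by simp [Valid]; omega)
  · exact hoff (p := 1) (q := 0) (i := i + 1) (mk_pow_mul mk_bga (map_mul _ _ _) i) rfl
      (by simp [Valid]; omega)
  · rcases h₂.lt_or_eq with h₂ | rfl
    · exact mem_wordSet (x := .d2 i) ⟨h₁, h₂⟩
        (by rw [word, map_add, map_pow, map_pow, mk_abg, mk_gab])
    · exact mem_wordSet (x := .dk) trivial
        (by rw [word, map_add, map_pow, map_pow, mk_abg, mk_gab])

theorem exists_NN_subset_wordSet (hk : 1 ≤ k) (hs : 1 ≤ s) : ∃ u v : F,
    (u ≠ 0 → 2 ≤ k) ∧ (v ≠ 0 → 2 ≤ s) ∧ NN F k s c ⊆ wordSet F k s c u v := by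
  have hn1 (u v : F) {y : DA F k s c}
      (h : y = Al F k s c + u • (ABG F k s c) ^ (k / 2) + v • (Et F k s c) ^ (s / 2)) :
      y ∈ wordSet F k s c u v := by
    refine mem_wordSet (x := .n1) trivial ?_
    rw [h, word, map_add, map_add, map_smul, map_smul, map_pow, map_pow, mk_abg]
    rfl
  have hn2 (u : F) (h : 2 ≤ k ∧ 2 ≤ s) :
      (ABG F k s c) ^ (k / 2) + (Et F k s c) ^ (s / 2) ∈ wordSet F k s c u 0 := by
    refine mem_wordSet (x := .n2) ⟨rfl, h⟩ ?_
    rw [word, map_add, map_pow, map_pow, mk_abg]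
    rfl
  have hev {n : ℕ} (hn : 1 ≤ n) (h : ¬ Odd n) : 2 ≤ n := by grind
  unfold NN
  split_ifs with h₀ h₁ h₁ h₂ h₃
  · exact ⟨0, 0, by simp, by simp, Set.singleton_subset_iff.2 (hn1 0 0 (by simp))⟩
  · push Not at h₁
    exact ⟨0, 0, by simp, by simp, Set.insert_subset (hn1 0 0 (by simp))
      (Set.singleton_subset_iff.2 (hn2 0 ⟨hev hk h₁.1, hev hs h₁.2⟩))⟩
  · exact ⟨0, 0, by simp, by simp, Set.empty_subset _⟩
  · exact ⟨0, 1, by simp, fun _ => hev hs (Nat.not_odd_iff_even.2 h₂.2),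
      Set.singleton_subset_iff.2 (hn1 0 1 (by simp))⟩
  · exact ⟨1, 0, fun _ => hev hk (Nat.not_odd_iff_even.2 h₃.1), by simp,
      Set.singleton_subset_iff.2 (hn1 1 0 (by simp))⟩
  · have h : 2 ≤ k ∧ 2 ≤ s := by grind
    exact ⟨1, 0, fun _ => h.1, by simp, Set.insert_subset (hn1 1 0 (by simp))
      (Set.singleton_subset_iff.2 (hn2 1 h))⟩

theorem linearIndepOn_TT [CharP F 2] (hk : 1 ≤ k) (hs : 1 ≤ s) :
    LinearIndepOn F id (TT F k s c) := by
  obtain ⟨u, v, hu, hv, h⟩ := exists_NN_subset_wordSet (F := F) (c := c) hk hs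
  refine (linearIndepOn_wordSet hk hs hu hv).mono ?_
  rintro _ (((hx | ⟨i, ⟨h₁, h₂⟩, rfl⟩) | ⟨j, ⟨h₁, h₂⟩, rfl⟩) | hx)
  · exact KK_subset_wordSet hk u v hx
  · exact mem_wordSet (x := .top i) ⟨h₁, by omega⟩ ((map_pow _ _ _).trans (by rw [mk_abg]))
  · rcases h₂.lt_or_eq with h₂ | rfl
    · exact mem_wordSet (x := .eta j) ⟨h₁, h₂⟩ (map_pow _ _ _)
    · exact mem_wordSet (x := .etas) trivial (map_pow _ _ _)
  · exact h hx

end Basis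

section Trace

open Polynomial

variable {F k s c}

/-- The elements of the order that induce traces on the algebra. -/
def IsTracial (F : Type) [Field F] (k s : ℕ) (c : F) (Z : Model F) : Prop :=
  Z ∈ order F ∧ ∀ Y ∈ order F, ∀ Y' ∈ order F,
    modelTrace F k s c (Y * Y' * Z) = modelTrace F k s c (Y' * Y * Z)

theorem isTracial_of_comm {Z : Model F} (hZ : Z ∈ order F) (h : ∀ Y, Y * Z = Z * Y) :
    IsTracial F k s c Z := by
  refine ⟨hZ, fun Y _ Y' _ => ?_⟩
  rw [mul_assoc, modelTrace_mul_comm, mul_assoc, ← h, mul_assoc]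

theorem isTracial_munit (hk : 1 ≤ k) : IsTracial F k s c (munit 0 0 (X ^ k)) := by
  refine ⟨by simp [mem_order_iff, coeff_X_pow]; omega, fun Y hY Y' hY' => ?_⟩
  obtain ⟨h₁, h₂, h₃, h₄, h₅, h₆⟩ := mem_order_iff.1 hY
  obtain ⟨g₁, g₂, g₃, g₄, g₅, g₆⟩ := mem_order_iff.1 hY'
  rw [modelTrace_mul_comm, modelTrace_munit_mul, modelTrace_mul_comm (Y' * Y),
    modelTrace_munit_mul]
  simp [coeff_X_pow_mul', Matrix.mul_apply, Fin.sum_univ_three, mul_coeff_zero, h₁, h₂, g₁, g₂,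
    mul_comm]

theorem map_sq_add [CharP F 2] {A : Type} [Ring A] [Algebra F A] {f : A →ₗ[F] F}
    (hf : ∀ u v, f (u * v) = f (v * u)) (x y : A) :
    f ((x + y) ^ 2) = f (x ^ 2) + f (y ^ 2) := by
  have h := map_eq_zero_of_mem_Kspan hf (add_sq_sub_mem_Kspan (F := F) x y)
  rwa [map_sub, sub_eq_zero, map_add] at h

theorem map_sq_sum [CharP F 2] {A : Type} [Ring A] [Algebra F A] {f : A →ₗ[F] F}
    (hf : ∀ u v, f (u * v) = f (v * u)) {ι : Type} (I : Finset ι) (g : ι → A) :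
    f ((∑ i ∈ I, g i) ^ 2) = ∑ i ∈ I, f (g i ^ 2) := by
  induction I using Finset.cons_induction with
  | empty => simp
  | cons i I hi ih => rw [Finset.sum_cons, Finset.sum_cons, map_sq_add hf, ih]

theorem trace_identity [CharP F 2] (hk : 1 ≤ k) (hs : 1 ≤ s) {x t : DA F k s c} {p q r : F}
    {u v : ℕ → F} (hx : x ^ 2 ∈ Kspan F (DA F k s c)) (ht : t ^ 2 ∈ Kspan F (DA F k s c))
    (h : x = t + (p • E1 F k s c + q • E2 F k s c + r • Al F k s c)
      + ∑ i ∈ Finset.Icc 1 (k - 1), u i • (ABG F k s c) ^ i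
      + ∑ j ∈ Finset.Icc 1 s, v j • (Et F k s c) ^ j) {Z : Model F} (hZ : IsTracial F k s c Z) :
    p ^ 2 * modelTrace F k s c (genModel F .e1 * Z)
      + q ^ 2 * modelTrace F k s c (genModel F .e2 * Z)
      + r ^ 2 * (c * Z.2.2.coeff 0)
      + ∑ i ∈ Finset.Icc 1 (k - 1), u i ^ 2 * (X ^ (2 * i) * Z.1 0 0).coeff k
      + ∑ j ∈ Finset.Icc 1 s, v j ^ 2 * (X ^ (2 * j) * Z.2.1).coeff s = 0 := by
  obtain ⟨f, hf⟩ := exists_functional (F := F) (c := c) hk hs hZ.1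
  have hcomm (y z : DA F k s c) : f (y * z) = f (z * y) := by
    obtain ⟨y, rfl⟩ := mk_surjective y
    obtain ⟨z, rfl⟩ := mk_surjective z
    rw [← map_mul, ← map_mul, hf, hf, map_mul (toModel F), map_mul (toModel F)]
    exact hZ.2 _ (toModel_mem_order F y) _ (toModel_mem_order F z)
  have hsq (r : F) (w : FreeAlgebra F Gen) :
      f ((r • mk F k s c w) ^ 2) = r ^ 2 * modelTrace F k s c (toModel F w * toModel F w * Z) := by
    rw [_root_.smul_pow, map_smul, ← map_pow, hf, sq w, map_mul (toModel F), smul_eq_mul]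
  have hE1 : f ((p • E1 F k s c) ^ 2) = p ^ 2 * modelTrace F k s c (genModel F .e1 * Z) := by
    have h : genModel F .e1 * genModel F .e1 = genModel F .e1 := by
      simp [genModel, add_mul, mul_add]
    rw [E1, hsq, toModel_gen, h]
  have hE2 : f ((q • E2 F k s c) ^ 2) = q ^ 2 * modelTrace F k s c (genModel F .e2 * Z) := by
    have h : genModel F .e2 * genModel F .e2 = genModel F .e2 := by simp [genModel]
    rw [E2, hsq, toModel_gen, h]
  have hAl : f ((r • Al F k s c) ^ 2) = r ^ 2 * (c * Z.2.2.coeff 0) := by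
    have h : genModel F .a * genModel F .a = ((0, 0, X ^ 2) : Model F) := by simp [genModel, sq]
    rw [Al, hsq, toModel_gen, h]
    simp [modelTrace_apply, coeff_X_pow_mul']
  have hABG {i : ℕ} (hi : 1 ≤ i) : f ((u i • (ABG F k s c) ^ i) ^ 2)
      = u i ^ 2 * (X ^ (2 * i) * Z.1 0 0).coeff k := by
    rw [← mk_abg, ← map_pow, hsq, toModel_pow (toModel_abg F) hi, munit_mul_munit, if_pos rfl,
      modelTrace_munit_mul, ← pow_add, two_mul]
  have hEt {j : ℕ} (hj : 1 ≤ j) : f ((v j • (Et F k s c) ^ j) ^ 2)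
      = v j ^ 2 * (X ^ (2 * j) * Z.2.1).coeff s := by
    rw [Et, ← map_pow, hsq, toModel_h_pow hj]
    simp [modelTrace_apply, ← pow_add, two_mul]
  have h0 := map_eq_zero_of_mem_Kspan hcomm hx
  rw [h, map_sq_add hcomm, map_sq_add hcomm, map_sq_add hcomm, map_sq_add hcomm, map_sq_add hcomm,
    map_eq_zero_of_mem_Kspan hcomm ht, zero_add, hE1, hE2, hAl, map_sq_sum hcomm,
    map_sq_sum hcomm] at h0
  rw [← h0]
  congr 1
  · congr 1
    exact Finset.sum_congr rfl fun i hi => (hABG (Finset.mem_Icc.1 hi).1).symm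
  · exact Finset.sum_congr rfl fun j hj => (hEt (Finset.mem_Icc.1 hj).1).symm

theorem sum_ite_two_mul {M : Type} [AddCommMonoid M] {m n : ℕ} (hn : 1 ≤ n) (h : n / 2 ≤ m)
    (g : ℕ → M) : ∑ i ∈ Finset.Icc 1 m, (if 2 * i = n then g i else 0)
      = if Even n then g (n / 2) else 0 := by
  split_ifs with hev
  · rw [Finset.sum_eq_single (n / 2), if_pos (Nat.two_mul_div_two_of_even hev)]
    · intro i _ hi
      exact if_neg (by omega)
    · intro hi
      have := Nat.two_mul_div_two_of_even hev
      simp only [Finset.mem_Icc] at hi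
      omega
  · refine Finset.sum_eq_zero fun i _ => if_neg ?_
    rintro rfl
    simp at hev

/-- The conditions on the coefficients of an element of `T₁`. -/
theorem coefficients_of_sq_mem [CharP F 2] (hk : 1 ≤ k) (hs : 1 ≤ s) {x t : DA F k s c} {p q r : F}
    {u v : ℕ → F} (hx : x ^ 2 ∈ Kspan F (DA F k s c)) (ht : t ^ 2 ∈ Kspan F (DA F k s c))
    (h : x = t + (p • E1 F k s c + q • E2 F k s c + r • Al F k s c)
      + ∑ i ∈ Finset.Icc 1 (k - 1), u i • (ABG F k s c) ^ i
      + ∑ j ∈ Finset.Icc 1 s, v j • (Et F k s c) ^ j) :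
    p = 0 ∧ q = 0 ∧ (∀ i, 1 ≤ i → 2 * i < k → u i = 0) ∧ (∀ j, 1 ≤ j → 2 * j < s → v j = 0) ∧
      c * r ^ 2 + (if Even k then u (k / 2) else 0) ^ 2
        + (if Even s then v (s / 2) else 0) ^ 2 = 0 := by
  have key {Z : Model F} (hZ : IsTracial F k s c Z) := trace_identity hk hs hx ht h hZ
  have hp : p = 0 := by
    have := key (isTracial_munit hk)
    rw [Finset.sum_eq_zero, Finset.sum_eq_zero] at this
    · simpa [genModel, modelTrace_apply, Matrix.trace, Fin.sum_univ_three, coeff_X_pow] using this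
    · simp
    · intro i hi
      have := (Finset.mem_Icc.1 hi).1
      simp [← pow_add, coeff_X_pow]
      omega
  subst hp
  have hq : q = 0 := by
    have := key (Z := (0, X ^ s, 0)) (isTracial_of_comm
      (by simp [mem_order_iff, coeff_X_pow]; omega) fun Y => by ext <;> simp [mul_comm])
    rw [Finset.sum_eq_zero, Finset.sum_eq_zero] at this
    · simpa [genModel, modelTrace_apply, coeff_X_pow] using this
    · intro j hj
      have := (Finset.mem_Icc.1 hj).1
      simp [← pow_add, coeff_X_pow]
      omega
    · simp
  subst hq
  refine ⟨rfl, rfl, fun i h₁ h₂ => ?_, fun j h₁ h₂ => ?_, ?_⟩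
  · have := key (Z := ((X ^ (k - 2 * i) : F[X]) • (1 : Matrix (Fin 3) (Fin 3) F[X]), 0, 0))
      (isTracial_of_comm (by simp [mem_order_iff, coeff_X_pow]; omega) fun Y => by
        ext <;> simp)
    rw [Finset.sum_eq_single i] at this
    · simpa [← pow_add, Nat.add_sub_cancel' h₂.le] using this
    · intro j hj hij
      simp [← pow_add, coeff_X_pow]
      omega
    · intro hi
      simp at hi
      omega
  · have := key (Z := (0, X ^ (s - 2 * j), 0)) (isTracial_of_comm
      (by simp [mem_order_iff, coeff_X_pow]; omega) fun Y => by ext <;> simp [mul_comm])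
    rw [Finset.sum_eq_single (s := Finset.Icc 1 s) j] at this
    · simpa [← pow_add, Nat.add_sub_cancel' h₂.le] using this
    · intro i hi hij
      simp [← pow_add, coeff_X_pow]
      omega
    · intro hj
      simp at hj
      omega
  · have := key (isTracial_of_comm (one_mem _) fun Y => by rw [one_mul, mul_one])
    simp only [Prod.fst_one, Prod.snd_one, Matrix.one_apply_eq, mul_one, coeff_X_pow, mul_ite,
      mul_zero, coeff_one_zero, eq_comm (a := k), eq_comm (a := s)] at this
    rw [sum_ite_two_mul hk (by omega), sum_ite_two_mul hs (by omega)] at this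
    simpa [ite_pow, mul_comm c] using this

end Trace

section Main

variable {F k s c}

theorem sq_mem_Kspan_of_mem_NN [CharP F 2] (hk : 1 ≤ k) (hc : c = 0 ∨ c = 1) {x : DA F k s c}
    (hx : x ∈ NN F k s c) : x ^ 2 ∈ Kspan F (DA F k s c) := by
  have R := dRel_DA F k s c
  have hadd {y z : DA F k s c} (h : y ^ 2 + z ^ 2 ∈ Kspan F (DA F k s c)) :
      (y + z) ^ 2 ∈ Kspan F (DA F k s c) := by
    have := add_mem (add_sq_sub_mem_Kspan (F := F) y z) h
    rwa [sub_add_cancel] at this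
  have hAl : (Al F k s c) ^ 2 = c • (ABG F k s c) ^ k := (sq _).trans R.asq
  have hA (h : Even k) : ((ABG F k s c) ^ (k / 2)) ^ 2 = (ABG F k s c) ^ k := by
    rw [← pow_mul, Nat.div_two_mul_two_of_even h]
  have hE (h : Even s) : ((Et F k s c) ^ (s / 2)) ^ 2 = (GAB F k s c) ^ k := by
    rw [← pow_mul, Nat.div_two_mul_two_of_even h]
    exact R.hs
  have hK : (ABG F k s c) ^ k + (GAB F k s c) ^ k ∈ Kspan F (DA F k s c) :=
    KK_subset_Kspan hk (ABG_add_GAB_mem_KK hk le_rfl)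
  have hz : (ABG F k s c) ^ k + (ABG F k s c) ^ k ∈ Kspan F (DA F k s c) := by
    rw [add_self_eq_zero_of_char_two F]
    exact zero_mem _
  unfold NN at hx
  split_ifs at hx with h₀ h₁ h₁ h₂ h₃
  · rw [Set.mem_singleton_iff.1 hx, hAl, h₀, zero_smul]
    exact zero_mem _
  · simp only [not_or, Nat.not_odd_iff_even] at h₁
    rcases hx with rfl | rfl
    · rw [hAl, h₀, zero_smul]
      exact zero_mem _
    · exact hadd (by rwa [hA h₁.1, hE h₁.2])
  · exact hx.elim
  all_goals
    replace hAl : (Al F k s c) ^ 2 = (ABG F k s c) ^ k := by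
      rw [hAl, hc.resolve_left h₀, one_smul]
  · rw [Set.mem_singleton_iff.1 hx]
    exact hadd (by rwa [hAl, hE h₂.2])
  · rw [Set.mem_singleton_iff.1 hx]
    exact hadd (by rwa [hAl, hA h₃.1])
  · have hks : Even k ∧ Even s := by grind
    rcases hx with rfl | rfl
    · exact hadd (by rwa [hAl, hA hks.1])
    · exact hadd (by rwa [hA hks.1, hE hks.2])

theorem span_TT_le [CharP F 2] (hk : 1 ≤ k) (hc : c = 0 ∨ c = 1) :
    Submodule.span F (TT F k s c) ≤ T1sub F (DA F k s c) := by
  have R := dRel_DA F k s c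
  refine Submodule.span_le.2 ?_
  rintro x (((hx | ⟨i, hi, rfl⟩) | ⟨j, hj, rfl⟩) | hx)
  · exact Kspan_le_T1sub (KK_subset_Kspan hk hx)
  · change ((ABG F k s c) ^ i) ^ 2 ∈ Kspan F (DA F k s c)
    rw [← pow_mul, ABG, R.abg_pow_of_lt hk (by have := hi.1; omega)]
    exact zero_mem _
  · change ((Et F k s c) ^ j) ^ 2 ∈ Kspan F (DA F k s c)
    rw [← pow_mul, R.h_pow_of_lt hk (by have := hj.1; omega)]
    exact zero_mem _
  · exact sq_mem_Kspan_of_mem_NN hk hc hx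

theorem mem_span_NN [CharP F 2] (hc : c = 0 ∨ c = 1) {r u v : F}
    (h : c * r ^ 2 + (if Even k then u else 0) ^ 2 + (if Even s then v else 0) ^ 2 = 0) :
    r • Al F k s c + (if Even k then u • (ABG F k s c) ^ (k / 2) else 0)
      + (if Even s then v • (Et F k s c) ^ (s / 2) else 0) ∈ Submodule.span F (NN F k s c) := by
  have hmem {y : DA F k s c} (hy : y ∈ NN F k s c) (r : F) :
      r • y ∈ Submodule.span F (NN F k s c) :=
    Submodule.smul_mem _ _ (Submodule.subset_span hy)
  have heq {y z : F} (h : y ^ 2 + z ^ 2 = 0) : y = z := by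
    rw [← CharTwo.add_sq, sq_eq_zero_iff] at h
    exact CharTwo.add_eq_zero.1 h
  have hpar (n : ℕ) : Even n ∧ ¬ Odd n ∨ ¬ Even n ∧ Odd n := by grind
  rcases hc with rfl | rfl <;> rcases hpar k with ⟨hk, hk'⟩ | ⟨hk, hk'⟩ <;>
    rcases hpar s with ⟨hs, hs'⟩ | ⟨hs, hs'⟩ <;>
    simp only [hk, hs, if_true, if_false, zero_mul, one_mul, zero_add, add_zero, ne_eq,
      OfNat.ofNat_ne_zero, not_false_eq_true, zero_pow, pow_eq_zero_iff] at h ⊢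
  · rw [heq h, add_assoc, ← smul_add]
    exact add_mem (hmem (by simp [NN, hk', hs']) r) (hmem (by simp [NN, hk', hs']) v)
  · rw [h, zero_smul, add_zero]
    exact hmem (by simp [NN, hk', hs']) r
  · rw [h, zero_smul, add_zero]
    exact hmem (by simp [NN, hk', hs']) r
  · exact hmem (by simp [NN, hk', hs']) r
  · rw [← CharTwo.add_sq] at h
    have h' : r • Al F k s 1 + u • (ABG F k s 1) ^ (k / 2) + v • (Et F k s 1) ^ (s / 2)
        = r • (Al F k s 1 + (ABG F k s 1) ^ (k / 2))
          + v • ((ABG F k s 1) ^ (k / 2) + (Et F k s 1) ^ (s / 2)) := by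
      have hu : u = r + v := by
        rw [← heq h, ← add_assoc, CharTwo.add_self_eq_zero, zero_add]
      rw [hu]
      module
    rw [h']
    exact add_mem (hmem (by simp [NN, hk', hs']) r) (hmem (by simp [NN, hk', hs']) v)
  · rw [← heq h, ← smul_add]
    exact hmem (by simp [NN, hk, hs, hk', hs']) r
  · rw [← heq h, ← smul_add]
    exact hmem (by simp [NN, hs, hk', hs']) r
  · rw [h, zero_smul]
    exact zero_mem _

theorem le_span_TT [CharP F 2] (hk : 1 ≤ k) (hs : 1 ≤ s) (hc : c = 0 ∨ c = 1) :
    T1sub F (DA F k s c) ≤ Submodule.span F (TT F k s c) := by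
  intro x hx
  obtain ⟨t, ht, p, q, r, u, v, h⟩ := exists_eq_mod_KK hk hs x
  obtain ⟨rfl, rfl, hu, hv, huv⟩ := coefficients_of_sq_mem hk hs hx
    (Kspan_le_T1sub (Submodule.span_le.2 (KK_subset_Kspan hk) ht)) h
  have hsum {m n : ℕ} (hn : 1 ≤ n) (hm : n / 2 ≤ m) (w : ℕ → F) (y : ℕ → DA F k s c)
      (hw : ∀ i, 1 ≤ i → 2 * i < n → w i = 0)
      (hy : ∀ i ∈ Set.Icc ((n + 2) / 2) m, y i ∈ TT F k s c) :
      ∑ i ∈ Finset.Icc 1 m, w i • y i - (if Even n then w (n / 2) • y (n / 2) else 0)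
        ∈ Submodule.span F (TT F k s c) := by
    rw [← sum_ite_two_mul hn hm fun i => w i • y i, ← Finset.sum_sub_distrib]
    refine Submodule.sum_mem _ fun i hi => ?_
    rw [Finset.mem_Icc] at hi
    rcases lt_trichotomy (2 * i) n with h | h | h
    · simp [hw i hi.1 h]
    · simp [h]
    · rw [if_neg (by omega), sub_zero]
      exact Submodule.smul_mem _ _ (Submodule.subset_span (hy i ⟨by omega, hi.2⟩))
  have hA := hsum hk (by omega) u (fun i => (ABG F k s c) ^ i) hu
    fun i hi => .inl (.inl (.inr ⟨i, hi, rfl⟩))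
  have hE := hsum hs (by omega) v (fun j => (Et F k s c) ^ j) hv
    fun j hj => .inl (.inr ⟨j, hj, rfl⟩)
  have hN : Submodule.span F (NN F k s c) ≤ Submodule.span F (TT F k s c) :=
    Submodule.span_mono fun y hy => .inr hy
  have hK : Submodule.span F (KK F k s c) ≤ Submodule.span F (TT F k s c) :=
    Submodule.span_mono fun y hy => .inl (.inl (.inl hy))
  have hx' := add_mem (add_mem (add_mem (hK ht) (hN (mem_span_NN hc huv))) hA) hE
  rw [h]
  convert hx' using 1
  simp only [zero_smul, zero_add]
  abel

end Main

/-- **Lemma 4.3 (basis of `T₁(A^{k,s}_c)`, dihedral type).**  For `k, s ≥ 1` and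
`c ∈ {0,1}` the set 𝓣 is an F-basis of `T₁(A^{k,s}_c) = {x : x² ∈ K(A^{k,s}_c)}`. -/
theorem dihedral_T1_basis
    (F : Type) [Field F] [IsAlgClosed F] [CharP F 2]
    (k s : ℕ) (hk : 1 ≤ k) (hs : 1 ≤ s) (c : F) (hc : c = 0 ∨ c = 1) :
    LinearIndependent F (fun p : (TT F k s c) => (p : DA F k s c)) ∧
    (Submodule.span F (TT F k s c) : Set (DA F k s c)) = T1set F k s c :=
  ⟨linearIndepOn_TT hk hs, congrArg _ (le_antisymm (span_TT_le hk hc) (le_span_TT hk hs hc))⟩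

end DihedralPaper

end
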